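/- arXiv:1710.00427 — 6 statements merged into one kernel-verified Lean document; each statement's English description precedes it below -/
import Mathlib

section
/- Let S ⊆ M_d and R ⊆ M_{d'} be sets of matrices. Suppose that for every s ∈ S there is a projection p in the linear span of S with p·s = s, and for every r ∈ R there is a projection q in the linear span of R with r·q = r. Then the (non-unital) subalgebra of M_d ⊗ M_{d'} generated by S⊗R = {s⊗r : s∈S, r∈R} equals the tensor product alg(S) ⊗ alg(R) of the subalgebras generated by S and by R. If moreover such projections also exist for every element of S* = {s* : s ∈ S} and of R* = {r* : r ∈ R}, then the *-subalgebra generated by S⊗R equals alg*(S) ⊗ alg*(R). -/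
open scoped Kronecker

/-- A subspace contained in its square is contained in all its positive powers, increasingly. -/
theorem Submodule.pow_succ_mono_of_le_mul_self {K A : Type*} [CommSemiring K] [Semiring A]
    [Algebra K A] {V : Submodule K A} (hV : V ≤ V * V) : Monotone fun n : ℕ => V ^ (n + 1) := by
  refine monotone_nat_of_le_succ fun n => ?_
  calc V ^ (n + 1) = V ^ n * V := pow_succ _ _
    _ ≤ V ^ n * (V * V) := by gcongr
    _ = V ^ (n + 1 + 1) := by rw [pow_succ, pow_succ, mul_assoc]

theorem NonUnitalAlgebra.exists_mem_span_pow_of_mem_adjoin {K A : Type*} [CommRing K] [Ring A]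
    [Algebra K A] {S : Set A} (hS : Submodule.span K S ≤ Submodule.span K S * Submodule.span K S)
    {a : A} (ha : a ∈ NonUnitalAlgebra.adjoin K S) :
    ∃ n : ℕ, a ∈ Submodule.span K S ^ (n + 1) := by
  have hmono := Submodule.pow_succ_mono_of_le_mul_self hS
  induction ha using NonUnitalAlgebra.adjoin_induction with
  | mem x hx => exact ⟨0, by simpa using Submodule.subset_span hx⟩
  | add x y _ _ hx hy =>
    obtain ⟨m, hm⟩ := hx
    obtain ⟨n, hn⟩ := hy
    exact ⟨max m n, add_mem (hmono (le_max_left m n) hm) (hmono (le_max_right m n) hn)⟩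
  | zero => exact ⟨0, zero_mem _⟩
  | mul x y _ _ hx hy =>
    obtain ⟨m, hm⟩ := hx
    obtain ⟨n, hn⟩ := hy
    refine ⟨m + 1 + n, ?_⟩
    rw [add_assoc (m + 1), pow_add]
    exact Submodule.mul_mem_mul hm hn
  | smul c x _ hx =>
    obtain ⟨m, hm⟩ := hx
    exact ⟨m, Submodule.smul_mem _ c hm⟩

theorem Submodule.span_le_mul_self_of_forall_exists_mul_eq {K A : Type*} [CommSemiring K]
    [Semiring A] [Algebra K A] {S : Set A}
    (hS : ∀ s ∈ S, ∃ p ∈ Submodule.span K S, ∃ q ∈ Submodule.span K S, p * q = s) :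
    Submodule.span K S ≤ Submodule.span K S * Submodule.span K S := by
  refine Submodule.span_le.2 fun s hs => ?_
  obtain ⟨p, hp, q, hq, h⟩ := hS s hs
  exact h ▸ Submodule.mul_mem_mul hp hq

section Kronecker

variable {K m n : Type*} [CommRing K]

theorem Matrix.kronecker_mem_of_mem_span {S : Set (Matrix m m K)} {R : Set (Matrix n n K)}
    {V : Submodule K (Matrix (m × n) (m × n) K)} (h : ∀ s ∈ S, ∀ r ∈ R, s ⊗ₖ r ∈ V)
    {a : Matrix m m K} (ha : a ∈ Submodule.span K S)
    {b : Matrix n n K} (hb : b ∈ Submodule.span K R) : a ⊗ₖ b ∈ V := by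
  have hmem := Submodule.apply_mem_map₂
    (Matrix.kroneckerBilinear : Matrix m m K →ₗ[K] Matrix n n K →ₗ[K] _) ha hb
  rw [Submodule.map₂_span_span] at hmem
  refine Submodule.span_le.2 ?_ hmem
  rintro _ ⟨s, hs, r, hr, rfl⟩
  exact h s hs r hr

variable [Fintype m] [DecidableEq m] [Fintype n] [DecidableEq n]

theorem Matrix.kronecker_mem_of_mem_adjoin {S : Set (Matrix m m K)} {R : Set (Matrix n n K)}
    {C : NonUnitalSubalgebra K (Matrix (m × n) (m × n) K)}
    (hS : Submodule.span K S ≤ Submodule.span K S * Submodule.span K S)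
    (hR : Submodule.span K R ≤ Submodule.span K R * Submodule.span K R)
    (h : ∀ s ∈ S, ∀ r ∈ R, s ⊗ₖ r ∈ C)
    {a : Matrix m m K} (ha : a ∈ NonUnitalAlgebra.adjoin K S)
    {b : Matrix n n K} (hb : b ∈ NonUnitalAlgebra.adjoin K R) : a ⊗ₖ b ∈ C := by
  have hspan : ∀ a ∈ Submodule.span K S, ∀ b ∈ Submodule.span K R, a ⊗ₖ b ∈ C :=
    fun a ha b hb => Matrix.kronecker_mem_of_mem_span (V := C.toSubmodule) h ha hb
  have hpow (k : ℕ) : ∀ a ∈ Submodule.span K S ^ (k + 1), ∀ b ∈ Submodule.span K R ^ (k + 1),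
      a ⊗ₖ b ∈ C := by
    induction k with
    | zero => simpa using hspan
    | succ k ih =>
      intro a ha b hb
      rw [pow_succ] at ha hb
      induction ha using Submodule.mul_induction_on' with
      | mem_mul_mem x hx y hy =>
        induction hb using Submodule.mul_induction_on' with
        | mem_mul_mem z hz w hw =>
          rw [Matrix.mul_kronecker_mul]
          exact mul_mem (ih x hx z hz) (hspan y hy w hw)
        | add z _ w _ hz hw =>
          rw [Matrix.kronecker_add]
          exact add_mem hz hw
      | add x _ y _ hx hy =>
        rw [Matrix.add_kronecker]
        exact add_mem hx hy
  obtain ⟨i, hi⟩ := NonUnitalAlgebra.exists_mem_span_pow_of_mem_adjoin hS ha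
  obtain ⟨j, hj⟩ := NonUnitalAlgebra.exists_mem_span_pow_of_mem_adjoin hR hb
  exact hpow (max i j) _ (Submodule.pow_succ_mono_of_le_mul_self hS (le_max_left i j) hi) _
    (Submodule.pow_succ_mono_of_le_mul_self hR (le_max_right i j) hj)

theorem Matrix.adjoin_subset_span_kronecker {A : NonUnitalSubalgebra K (Matrix m m K)}
    {B : NonUnitalSubalgebra K (Matrix n n K)} {T : Set (Matrix (m × n) (m × n) K)}
    (hT : ∀ t ∈ T, ∃ a ∈ A, ∃ b ∈ B, t = a ⊗ₖ b) :
    (NonUnitalAlgebra.adjoin K T : Set (Matrix (m × n) (m × n) K)) ⊆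
      Submodule.span K {z | ∃ a ∈ A, ∃ b ∈ B, z = a ⊗ₖ b} := by
  intro x hx
  induction hx using NonUnitalAlgebra.adjoin_induction with
  | mem x hx => exact Submodule.subset_span (hT x hx)
  | add x y _ _ hx hy => exact add_mem hx hy
  | zero => exact zero_mem _
  | smul c x _ hx => exact Submodule.smul_mem _ c hx
  | mul x y _ _ hx hy =>
    have hxy := Submodule.mul_mem_mul hx hy
    rw [Submodule.span_mul_span] at hxy
    refine Submodule.span_mono ?_ hxy
    rintro _ ⟨_, ⟨a, ha, b, hb, rfl⟩, _, ⟨a', ha', b', hb', rfl⟩, rfl⟩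
    exact ⟨a * a', mul_mem ha ha', b * b', mul_mem hb hb', (Matrix.mul_kronecker_mul ..).symm⟩

end Kronecker

/-- If every element of `S` (resp. `R`) admits a projection in the span of
`S` (resp. `R`) acting as a left (resp. right) unit for it, then the non-unital subalgebra
generated by `S ⊗ R` is the tensor product `alg(S) ⊗ alg(R)` (the span of products
`a ⊗ₖ b` with `a ∈ alg(S)`, `b ∈ alg(R)`); and under the analogous hypotheses for `S*`
and `R*`, the same holds for the generated *-subalgebras. -/
theorem stmt0 (d d' : ℕ)
    (S : Set (Matrix (Fin d) (Fin d) ℂ)) (R : Set (Matrix (Fin d') (Fin d') ℂ))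
    (hS : ∀ s ∈ S, ∃ p ∈ Submodule.span ℂ S, p * p = p ∧ star p = p ∧ p * s = s)
    (hR : ∀ r ∈ R, ∃ q ∈ Submodule.span ℂ R, q * q = q ∧ star q = q ∧ r * q = r) :
    ((NonUnitalAlgebra.adjoin ℂ {z | ∃ s ∈ S, ∃ r ∈ R, z = s ⊗ₖ r} :
        NonUnitalSubalgebra ℂ (Matrix (Fin d × Fin d') (Fin d × Fin d') ℂ)) : Set _) =
      SetLike.coe (Submodule.span ℂ {z | ∃ a ∈ NonUnitalAlgebra.adjoin ℂ S,
          ∃ b ∈ NonUnitalAlgebra.adjoin ℂ R, z = a ⊗ₖ b}) ∧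
    ((∀ s ∈ S, ∃ p ∈ Submodule.span ℂ S, p * p = p ∧ star p = p ∧ p * star s = star s) →
     (∀ r ∈ R, ∃ q ∈ Submodule.span ℂ R, q * q = q ∧ star q = q ∧ star r * q = star r) →
      ((NonUnitalStarAlgebra.adjoin ℂ {z | ∃ s ∈ S, ∃ r ∈ R, z = s ⊗ₖ r} :
          NonUnitalStarSubalgebra ℂ (Matrix (Fin d × Fin d') (Fin d × Fin d') ℂ)) : Set _) =
        SetLike.coe (Submodule.span ℂ {z | ∃ a ∈ NonUnitalStarAlgebra.adjoin ℂ S,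
            ∃ b ∈ NonUnitalStarAlgebra.adjoin ℂ R, z = a ⊗ₖ b})) := by
  have hSV : Submodule.span ℂ S ≤ Submodule.span ℂ S * Submodule.span ℂ S :=
    Submodule.span_le_mul_self_of_forall_exists_mul_eq fun s hs =>
      let ⟨p, hp, _, _, h⟩ := hS s hs
      ⟨p, hp, s, Submodule.subset_span hs, h⟩
  have hRW : Submodule.span ℂ R ≤ Submodule.span ℂ R * Submodule.span ℂ R :=
    Submodule.span_le_mul_self_of_forall_exists_mul_eq fun r hr =>
      let ⟨q, hq, _, _, h⟩ := hR r hr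
      ⟨r, Submodule.subset_span hr, q, hq, h⟩
  refine ⟨Set.Subset.antisymm (Matrix.adjoin_subset_span_kronecker ?_) ?_, fun hS' hR' => ?_⟩
  · rintro _ ⟨s, hs, r, hr, rfl⟩
    exact ⟨s, NonUnitalAlgebra.subset_adjoin ℂ hs, r, NonUnitalAlgebra.subset_adjoin ℂ hr, rfl⟩
  · refine (Submodule.span_le (p := (NonUnitalAlgebra.adjoin ℂ {z | ∃ s ∈ S, ∃ r ∈ R,
      z = s ⊗ₖ r}).toSubmodule)).2 ?_
    rintro _ ⟨a, ha, b, hb, rfl⟩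
    exact Matrix.kronecker_mem_of_mem_adjoin hSV hRW
      (fun s hs r hr => NonUnitalAlgebra.subset_adjoin ℂ
        (s := {z | ∃ s ∈ S, ∃ r ∈ R, z = s ⊗ₖ r}) ⟨s, hs, r, hr, rfl⟩) ha hb
  let C := NonUnitalStarAlgebra.adjoin ℂ
    {z : Matrix (Fin d × Fin d') (Fin d × Fin d') ℂ | ∃ s ∈ S, ∃ r ∈ R, z = s ⊗ₖ r}
  have hVW : ∀ a ∈ Submodule.span ℂ S, ∀ b ∈ Submodule.span ℂ R, a ⊗ₖ b ∈ C :=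
    fun a ha b hb => Matrix.kronecker_mem_of_mem_span (V := C.toSubmodule)
      (fun s hs r hr => NonUnitalStarAlgebra.subset_adjoin ℂ _ ⟨s, hs, r, hr, rfl⟩) ha hb
  have hstar : ∀ a b, star a ∈ Submodule.span ℂ S → star b ∈ Submodule.span ℂ R → a ⊗ₖ b ∈ C := by
    intro a b ha hb
    have := star_mem (hVW _ ha _ hb)
    rwa [Matrix.star_eq_conjTranspose, Matrix.conjTranspose_kronecker,
      ← Matrix.star_eq_conjTranspose, ← Matrix.star_eq_conjTranspose, star_star, star_star] at this
  have hgen : ∀ s ∈ S ∪ star S, ∀ r ∈ R ∪ star R, s ⊗ₖ r ∈ C := by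
    rintro s (hs | hs) r (hr | hr)
    · exact hVW _ (Submodule.subset_span hs) _ (Submodule.subset_span hr)
    · obtain ⟨p, hp, -, hp', hps⟩ := hS s hs
      obtain ⟨q, hq, -, -, hqr⟩ := hR' _ hr
      rw [star_star] at hqr
      rw [← hps, ← hqr, Matrix.mul_kronecker_mul]
      exact mul_mem (hstar _ _ (hp'.symm ▸ hp) (Submodule.subset_span hr))
        (hVW _ (Submodule.subset_span hs) _ hq)
    · obtain ⟨p, hp, -, -, hps⟩ := hS' _ hs
      obtain ⟨q, hq, -, hq', hqr⟩ := hR r hr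
      rw [star_star] at hps
      rw [← hps, ← hqr, Matrix.mul_kronecker_mul]
      exact mul_mem (hVW _ hp _ (Submodule.subset_span hr))
        (hstar _ _ (Submodule.subset_span hs) (hq'.symm ▸ hq))
    · exact hstar _ _ (Submodule.subset_span hs) (Submodule.subset_span hr)
  have hSV' : Submodule.span ℂ (S ∪ star S) ≤
      Submodule.span ℂ (S ∪ star S) * Submodule.span ℂ (S ∪ star S) := by
    refine Submodule.span_le_mul_self_of_forall_exists_mul_eq ?_
    have hmono := Submodule.span_mono (R := ℂ) (Set.subset_union_left (s := S) (t := star S))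
    rintro s (hs | hs)
    · obtain ⟨p, hp, -, -, h⟩ := hS s hs
      exact ⟨p, hmono hp, s, Submodule.subset_span (Or.inl hs), h⟩
    · obtain ⟨p, hp, -, -, h⟩ := hS' _ hs
      rw [star_star] at h
      exact ⟨p, hmono hp, s, Submodule.subset_span (Or.inr hs), h⟩
  have hRW' : Submodule.span ℂ (R ∪ star R) ≤
      Submodule.span ℂ (R ∪ star R) * Submodule.span ℂ (R ∪ star R) := by
    refine Submodule.span_le_mul_self_of_forall_exists_mul_eq ?_
    have hmono := Submodule.span_mono (R := ℂ) (Set.subset_union_left (s := R) (t := star R))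
    rintro r (hr | hr)
    · obtain ⟨q, hq, -, -, h⟩ := hR r hr
      exact ⟨r, Submodule.subset_span (Or.inl hr), q, hmono hq, h⟩
    · obtain ⟨q, hq, -, -, h⟩ := hR' _ hr
      rw [star_star] at h
      exact ⟨r, Submodule.subset_span (Or.inr hr), q, hmono hq, h⟩
  refine Set.Subset.antisymm (Matrix.adjoin_subset_span_kronecker
    (A := (NonUnitalStarAlgebra.adjoin ℂ S).toNonUnitalSubalgebra)
    (B := (NonUnitalStarAlgebra.adjoin ℂ R).toNonUnitalSubalgebra) ?_) ?_
  · rintro t (⟨s, hs, r, hr, rfl⟩ | ⟨s, hs, r, hr, ht⟩)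
    · exact ⟨s, NonUnitalStarAlgebra.subset_adjoin ℂ S hs,
        r, NonUnitalStarAlgebra.subset_adjoin ℂ R hr, rfl⟩
    · refine ⟨star s, NonUnitalStarAlgebra.star_subset_adjoin ℂ S (Set.star_mem_star.2 hs),
        star r, NonUnitalStarAlgebra.star_subset_adjoin ℂ R (Set.star_mem_star.2 hr), ?_⟩
      rw [← star_star t, ht, Matrix.star_eq_conjTranspose, Matrix.conjTranspose_kronecker]
      rfl
  · refine (Submodule.span_le (p := C.toSubmodule)).2 ?_
    rintro _ ⟨a, ha, b, hb, rfl⟩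
    exact Matrix.kronecker_mem_of_mem_adjoin (C := C.toNonUnitalSubalgebra) hSV' hRW' hgen ha hb
end

section
/- For any two unital quantum channels E₁ : M_d → M_d and E₂ : M_{d'} → M_{d'}, the multiplicative domain of their tensor product splits: M_{E₁⊗E₂} = M_{E₁} ⊗ M_{E₂} (as subalgebras of M_d ⊗ M_{d'} ≅ M_{dd'}). -/
open scoped Kronecker ComplexOrder

noncomputable section

/-- The amplification `1_n ⊗ E` of a linear map on matrices, acting on `M_n ⊗ M_ι`. -/
def ampl {ι : Type*} [Fintype ι] (n : ℕ)
    (E : Module.End ℂ (Matrix ι ι ℂ))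
    (A : Matrix (Fin n × ι) (Fin n × ι) ℂ) :
    Matrix (Fin n × ι) (Fin n × ι) ℂ :=
  Matrix.of fun p q => E (Matrix.of fun a b => A (p.1, a) (q.1, b)) p.2 q.2

/-- A quantum channel: completely positive (every amplification preserves positive
semidefiniteness) and trace preserving. -/
def IsQuantumChannel {ι : Type*} [Fintype ι] (E : Module.End ℂ (Matrix ι ι ℂ)) : Prop :=
  (∀ (n : ℕ) (A : Matrix (Fin n × ι) (Fin n × ι) ℂ),
      A.PosSemidef → (ampl n E A).PosSemidef) ∧
    ∀ x : Matrix ι ι ℂ, (E x).trace = x.trace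

/-- The multiplicative domain of a linear map on a matrix algebra. -/
def multDomain {ι : Type*} [Fintype ι] (E : Module.End ℂ (Matrix ι ι ℂ)) :
    Set (Matrix ι ι ℂ) :=
  {x | ∀ y, E (x * y) = E x * E y ∧ E (y * x) = E y * E x}

/-- The multiplicative index: the least `n ≥ 1` from which the chain of multiplicative
domains of the powers of `E` has stabilized. -/
def multIndex {ι : Type*} [Fintype ι] (E : Module.End ℂ (Matrix ι ι ℂ)) : ℕ :=
  sInf {n | 0 < n ∧ ∀ m, n ≤ m → multDomain (E ^ m) = multDomain (E ^ n)}

/-- The stabilized multiplicative domain `M_{E^∞}`. -/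
def stabMultDomain {ι : Type*} [Fintype ι] (E : Module.End ℂ (Matrix ι ι ℂ)) :
    Set (Matrix ι ι ℂ) :=
  ⋂ (n : ℕ) (_ : 0 < n), multDomain (E ^ n)

section MultiplicativeDomain

open Matrix

variable {ι κ : Type*} [Fintype ι] [Fintype κ]

/-- The squared Hilbert-Schmidt norm of a matrix. -/
def hsNormSq (x : Matrix ι ι ℂ) : ℝ := ∑ i, ∑ j, Complex.normSq (x i j)

theorem trace_conjTranspose_mul_self (x : Matrix ι ι ℂ) :
    (xᴴ * x).trace = (hsNormSq x : ℂ) := by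
  simp only [Matrix.trace, Matrix.diag, Matrix.mul_apply, Matrix.conjTranspose_apply, hsNormSq]
  push_cast
  rw [Finset.sum_comm]
  simp [Complex.normSq_eq_conj_mul_self]

theorem hsNormSq_conjTranspose (x : Matrix ι ι ℂ) : hsNormSq xᴴ = hsNormSq x := by
  simp only [hsNormSq, Matrix.conjTranspose_apply]
  rw [Finset.sum_comm]
  simp [Complex.normSq_apply]

/-- The multiplicative domain as a submodule. -/
def multDomainSubmodule (E : Module.End ℂ (Matrix ι ι ℂ)) :
    Submodule ℂ (Matrix ι ι ℂ) where
  carrier := multDomain E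
  add_mem' {a b} ha hb y := by
    simp only [add_mul, mul_add, map_add, (ha y).1, (ha y).2, (hb y).1, (hb y).2, and_self]
  zero_mem' y := by simp
  smul_mem' c a ha y := by
    simp only [smul_mul_assoc, mul_smul_comm, map_smul, (ha y).1, (ha y).2, and_self]

section Channel

variable [DecidableEq ι] {E : Module.End ℂ (Matrix ι ι ℂ)}

/-- The block matrix with blocks `1`, `x`, `xᴴ`, `xᴴ * x`. -/
def schwarzBlock (x : Matrix ι ι ℂ) : Matrix (Fin 2 × ι) (Fin 2 × ι) ℂ :=
  Matrix.of fun p q => ((![1, x] p.1)ᴴ * ![1, x] q.1) p.2 q.2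

theorem schwarzBlock_posSemidef (x : Matrix ι ι ℂ) : (schwarzBlock x).PosSemidef := by
  have h : schwarzBlock x = (Matrix.of fun a (q : Fin 2 × ι) => ![1, x] q.1 a q.2)ᴴ *
      (Matrix.of fun a (q : Fin 2 × ι) => ![1, x] q.1 a q.2) := by
    ext p q
    simp [schwarzBlock, Matrix.mul_apply]
  rw [h]
  exact Matrix.posSemidef_conjTranspose_mul_self _

theorem ampl_schwarzBlock_apply (x : Matrix ι ι ℂ) (p q : Fin 2 × ι) :
    ampl 2 E (schwarzBlock x) p q = E ((![1, x] p.1)ᴴ * ![1, x] q.1) p.2 q.2 := rfl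

theorem IsQuantumChannel.map_conjTranspose (h : IsQuantumChannel E) (x : Matrix ι ι ℂ) :
    E xᴴ = (E x)ᴴ := by
  ext a b
  have := (h.1 2 _ (schwarzBlock_posSemidef x)).isHermitian.apply (1, a) (0, b)
  simpa [ampl_schwarzBlock_apply] using this.symm

/-- The Kadison-Schwarz inequality. -/
theorem IsQuantumChannel.schwarz (h : IsQuantumChannel E) (hu : E 1 = 1) (x : Matrix ι ι ℂ) :
    (E (xᴴ * x) - (E x)ᴴ * E x).PosSemidef := by
  have key := (h.1 2 _ (schwarzBlock_posSemidef x)).conjTranspose_mul_mul_same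
    (Matrix.of fun (p : Fin 2 × ι) b => ![-E x, 1] p.1 p.2 b)
  convert key using 1
  have hx := h.map_conjTranspose x
  have hS : ampl 2 E (schwarzBlock x) = Matrix.of fun p q =>
      ![![1, E x], ![(E x)ᴴ, E (xᴴ * x)]] p.1 q.1 p.2 q.2 := by
    ext ⟨p, a⟩ ⟨q, b⟩
    fin_cases p <;> fin_cases q <;> simp [ampl_schwarzBlock_apply, hu, hx]
  rw [hS]
  ext a b
  simp [Matrix.mul_apply, Fintype.sum_prod_type, Matrix.one_apply, Finset.sum_add_distrib,
    add_mul, apply_ite]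
  ring

theorem IsQuantumChannel.hsNormSq_map_le (h : IsQuantumChannel E) (hu : E 1 = 1)
    (x : Matrix ι ι ℂ) : hsNormSq (E x) ≤ hsNormSq x := by
  have := (h.schwarz hu x).trace_nonneg
  rw [Matrix.trace_sub, h.2, trace_conjTranspose_mul_self, trace_conjTranspose_mul_self,
    sub_nonneg] at this
  exact_mod_cast this

/-- If `2 Re (t a) + |t|² c` is nonnegative for all complex `t`, then `a = 0`. -/
theorem eq_zero_of_forall_re_mul_add_normSq_mul_nonneg {a : ℂ} {c : ℝ}
    (h : ∀ t : ℂ, 0 ≤ 2 * (t * a).re + Complex.normSq t * c) : a = 0 := by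
  by_contra ha
  have hpos : 0 < Complex.normSq a := Complex.normSq_pos.2 ha
  have h2 : 0 < 1 + |c| := by positivity
  have hs : 0 < (1 + |c|)⁻¹ := by positivity
  have hc : (1 + |c|)⁻¹ * c ≤ 1 := by
    rw [inv_mul_le_iff₀ h2]
    linarith [le_abs_self c]
  have := h (-((1 + |c|)⁻¹ : ℝ) * (starRingEnd ℂ) a)
  rw [mul_assoc, ← Complex.normSq_eq_conj_mul_self, map_mul, Complex.normSq_neg,
    Complex.normSq_ofReal, Complex.normSq_conj, ← Complex.ofReal_neg, ← Complex.ofReal_mul,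
    Complex.ofReal_re] at this
  have h3 := mul_pos hs hpos
  nlinarith

/-- A matrix whose quadratic form vanishes is zero. -/
theorem eq_zero_of_forall_star_dotProduct_mulVec {A : Matrix ι ι ℂ}
    (h : ∀ v : ι → ℂ, star v ⬝ᵥ (A *ᵥ v) = 0) : A = 0 := by
  rw [← (Matrix.toEuclideanLin (𝕜 := ℂ)).map_eq_zero_iff, ← inner_map_self_eq_zero]
  intro v
  rw [EuclideanSpace.inner_eq_star_dotProduct, Matrix.ofLp_toLpLin, Matrix.toLin'_apply,
    Matrix.dotProduct_star, dotProduct_comm, h, star_zero]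

theorem IsQuantumChannel.map_conjTranspose_mul (h : IsQuantumChannel E) (hu : E 1 = 1)
    {x : Matrix ι ι ℂ} (hx : hsNormSq (E x) = hsNormSq x) (y : Matrix ι ι ℂ) :
    E (xᴴ * y) = (E x)ᴴ * E y := by
  have hD : E (xᴴ * x) - (E x)ᴴ * E x = 0 := by
    rw [← (h.schwarz hu x).trace_eq_zero_iff, Matrix.trace_sub, h.2,
      trace_conjTranspose_mul_self, trace_conjTranspose_mul_self, hx, sub_self]
  rw [← sub_eq_zero]
  apply eq_zero_of_forall_star_dotProduct_mulVec
  intro v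
  apply eq_zero_of_forall_re_mul_add_normSq_mul_nonneg
    (c := (star v ⬝ᵥ ((E (yᴴ * y) - (E y)ᴴ * E y) *ᵥ v)).re)
  intro t
  have key := (Complex.nonneg_iff.1 ((h.schwarz hu (x + t • y)).dotProduct_mulVec_nonneg v)).1
  have hyx : E (yᴴ * x) - (E y)ᴴ * E x = (E (xᴴ * y) - (E x)ᴴ * E y)ᴴ := by
    simp [← h.map_conjTranspose]
  have hexp : E ((x + t • y)ᴴ * (x + t • y)) - (E (x + t • y))ᴴ * E (x + t • y) =
      (E (xᴴ * x) - (E x)ᴴ * E x) + t • (E (xᴴ * y) - (E x)ᴴ * E y) +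
      star t • (E (yᴴ * x) - (E y)ᴴ * E x) +
      (star t * t) • (E (yᴴ * y) - (E y)ᴴ * E y) := by
    simp only [Matrix.conjTranspose_add, Matrix.conjTranspose_smul, add_mul, mul_add, map_add,
      map_smul, smul_mul_assoc, mul_smul_comm, smul_sub, smul_add, smul_smul, mul_comm t (star t)]
    abel
  rw [hexp, hD, hyx] at key
  have hc : star v ⬝ᵥ ((E (xᴴ * y) - (E x)ᴴ * E y)ᴴ *ᵥ v) =
      star (star v ⬝ᵥ ((E (xᴴ * y) - (E x)ᴴ * E y) *ᵥ v)) := by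
    rw [← Matrix.star_dotProduct, Matrix.star_mulVec, ← Matrix.dotProduct_mulVec]
  simp only [zero_add, Matrix.add_mulVec, Matrix.smul_mulVec, dotProduct_add, dotProduct_smul,
    hc, smul_eq_mul] at key
  generalize star v ⬝ᵥ ((E (xᴴ * y) - (E x)ᴴ * E y) *ᵥ v) = a at *
  generalize star v ⬝ᵥ ((E (yᴴ * y) - (E y)ᴴ * E y) *ᵥ v) = b at *
  simp [Complex.normSq_apply] at key ⊢
  nlinarith

theorem IsQuantumChannel.mem_multDomain (h : IsQuantumChannel E) (hu : E 1 = 1)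
    {x : Matrix ι ι ℂ} (hx : hsNormSq (E x) = hsNormSq x) : x ∈ multDomain E := by
  intro y
  constructor
  · have := h.map_conjTranspose_mul hu (x := xᴴ)
      (by rw [h.map_conjTranspose, hsNormSq_conjTranspose, hsNormSq_conjTranspose, hx]) y
    simpa [h.map_conjTranspose] using this
  · have := congrArg Matrix.conjTranspose (h.map_conjTranspose_mul hu hx yᴴ)
    simpa [← h.map_conjTranspose] using this

end Channel

section Slices

variable {ι κ : Type*}

/-- The slice of a matrix on `ι × κ` at a pair of indices of the first factor. -/
def sliceLeft (i j : ι) : Matrix (ι × κ) (ι × κ) ℂ →ₗ[ℂ] Matrix κ κ ℂ where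
  toFun z := Matrix.of fun k l => z (i, k) (j, l)
  map_add' _ _ := rfl
  map_smul' _ _ := rfl

/-- The slice of a matrix on `ι × κ` at a pair of indices of the second factor. -/
def sliceRight (k l : κ) : Matrix (ι × κ) (ι × κ) ℂ →ₗ[ℂ] Matrix ι ι ℂ where
  toFun z := Matrix.of fun i j => z (i, k) (j, l)
  map_add' _ _ := rfl
  map_smul' _ _ := rfl

@[simp]
theorem sliceLeft_apply (i j : ι) (z : Matrix (ι × κ) (ι × κ) ℂ) (k l : κ) :
    sliceLeft i j z k l = z (i, k) (j, l) := rfl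

@[simp]
theorem sliceRight_apply (k l : κ) (z : Matrix (ι × κ) (ι × κ) ℂ) (i j : ι) :
    sliceRight k l z i j = z (i, k) (j, l) := rfl

/-- The map `1 ⊗ E`. -/
def mapLeft (E : Module.End ℂ (Matrix κ κ ℂ)) : Module.End ℂ (Matrix (ι × κ) (ι × κ) ℂ) where
  toFun z := Matrix.of fun p q => E (sliceLeft p.1 q.1 z) p.2 q.2
  map_add' _ _ := by ext; simp
  map_smul' _ _ := by ext; simp

/-- The map `E ⊗ 1`. -/
def mapRight (E : Module.End ℂ (Matrix ι ι ℂ)) : Module.End ℂ (Matrix (ι × κ) (ι × κ) ℂ) where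
  toFun z := Matrix.of fun p q => E (sliceRight p.2 q.2 z) p.1 q.1
  map_add' _ _ := by ext; simp
  map_smul' _ _ := by ext; simp

theorem sliceLeft_mapLeft (E : Module.End ℂ (Matrix κ κ ℂ)) (z : Matrix (ι × κ) (ι × κ) ℂ)
    (i j : ι) : sliceLeft i j (mapLeft E z) = E (sliceLeft i j z) := rfl

theorem sliceRight_mapRight (E : Module.End ℂ (Matrix ι ι ℂ)) (z : Matrix (ι × κ) (ι × κ) ℂ)
    (k l : κ) : sliceRight k l (mapRight E z) = E (sliceRight k l z) := rfl

theorem mapLeft_kronecker (E : Module.End ℂ (Matrix κ κ ℂ)) (x : Matrix ι ι ℂ)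
    (y : Matrix κ κ ℂ) : mapLeft E (x ⊗ₖ y) = x ⊗ₖ E y := by
  ext ⟨i, k⟩ ⟨j, l⟩
  have : sliceLeft i j (x ⊗ₖ y) = x i j • y := by ext; simp
  change E (sliceLeft i j (x ⊗ₖ y)) k l = _
  simp [this]

theorem mapRight_kronecker (E : Module.End ℂ (Matrix ι ι ℂ)) (x : Matrix ι ι ℂ)
    (y : Matrix κ κ ℂ) : mapRight E (x ⊗ₖ y) = E x ⊗ₖ y := by
  ext ⟨i, k⟩ ⟨j, l⟩
  have : sliceRight k l (x ⊗ₖ y) = y k l • x := by ext; simp [mul_comm]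
  change E (sliceRight k l (x ⊗ₖ y)) i j = _
  simp [this, mul_comm]

variable [Fintype ι] [DecidableEq ι]

theorem sum_single_kronecker_sliceLeft (z : Matrix (ι × κ) (ι × κ) ℂ) :
    z = ∑ i, ∑ j, Matrix.single i j (1 : ℂ) ⊗ₖ sliceLeft i j z := by
  ext ⟨i, k⟩ ⟨j, l⟩
  simp [Matrix.sum_apply, Matrix.single_apply, ite_and]

/-- Every matrix on a product is a sum of Kronecker products. -/
theorem kronecker_induction {p : Matrix (ι × κ) (ι × κ) ℂ → Prop}
    (add : ∀ x y, p x → p y → p (x + y)) (zero : p 0)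
    (kronecker : ∀ (x : Matrix ι ι ℂ) (y : Matrix κ κ ℂ), p (x ⊗ₖ y)) (z) : p z := by
  rw [sum_single_kronecker_sliceLeft z]
  exact Finset.sum_induction _ p add zero fun i _ =>
    Finset.sum_induction _ p add zero fun j _ => kronecker _ _

variable {E₁ : Module.End ℂ (Matrix ι ι ℂ)} {E₂ : Module.End ℂ (Matrix κ κ ℂ)}
  {F : Module.End ℂ (Matrix (ι × κ) (ι × κ) ℂ)}

theorem eq_mapRight_mapLeft (hF : ∀ x y, F (x ⊗ₖ y) = E₁ x ⊗ₖ E₂ y)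
    (z : Matrix (ι × κ) (ι × κ) ℂ) : F z = mapRight E₁ (mapLeft E₂ z) := by
  induction z using kronecker_induction with
  | add x y hx hy => simp only [map_add, hx, hy]
  | zero => simp only [map_zero]
  | kronecker x y => rw [hF, mapLeft_kronecker, mapRight_kronecker]

theorem eq_mapLeft_mapRight (hF : ∀ x y, F (x ⊗ₖ y) = E₁ x ⊗ₖ E₂ y)
    (z : Matrix (ι × κ) (ι × κ) ℂ) : F z = mapLeft E₂ (mapRight E₁ z) := by
  induction z using kronecker_induction with
  | add x y hx hy => simp only [map_add, hx, hy]
  | zero => simp only [map_zero]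
  | kronecker x y => rw [hF, mapRight_kronecker, mapLeft_kronecker]

/-- A matrix whose slices lie in two given subspaces lies in their tensor product. -/
theorem mem_span_kronecker_of_slices {S : Submodule ℂ (Matrix ι ι ℂ)}
    {T : Submodule ℂ (Matrix κ κ ℂ)} {z : Matrix (ι × κ) (ι × κ) ℂ}
    (hS : ∀ k l, sliceRight k l z ∈ S) (hT : ∀ i j, sliceLeft i j z ∈ T) :
    z ∈ Submodule.span ℂ {w | ∃ a ∈ S, ∃ b ∈ T, w = a ⊗ₖ b} := by
  obtain ⟨Q, hQ⟩ := S.subtype.exists_leftInverse_of_injective S.ker_subtype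
  have hQS (x : Matrix ι ι ℂ) (hx : x ∈ S) : (Q x : Matrix ι ι ℂ) = x :=
    congrArg Subtype.val (LinearMap.congr_fun hQ ⟨x, hx⟩)
  have hz : z = mapRight (S.subtype ∘ₗ Q) z := by
    ext ⟨i, k⟩ ⟨j, l⟩
    change sliceRight k l z i j = (Q (sliceRight k l z) : Matrix ι ι ℂ) i j
    rw [hQS _ (hS k l)]
  have hz' : z = ∑ i, ∑ j, (Q (Matrix.single i j (1 : ℂ)) : Matrix ι ι ℂ) ⊗ₖ
      sliceLeft i j z := by
    conv_lhs => rw [hz, sum_single_kronecker_sliceLeft z]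
    simp only [map_sum, mapRight_kronecker, LinearMap.comp_apply, Submodule.subtype_apply]
  rw [hz']
  exact Submodule.sum_mem _ fun i _ => Submodule.sum_mem _ fun j _ =>
    Submodule.subset_span ⟨_, (Q _).2, _, hT i j, rfl⟩

end Slices

section Norm

variable {E₁ : Module.End ℂ (Matrix ι ι ℂ)} {E₂ : Module.End ℂ (Matrix κ κ ℂ)}

theorem hsNormSq_eq_sum_sliceLeft (z : Matrix (ι × κ) (ι × κ) ℂ) :
    hsNormSq z = ∑ i, ∑ j, hsNormSq (sliceLeft i j z) := by
  simp only [hsNormSq, Fintype.sum_prod_type, sliceLeft_apply]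
  refine Finset.sum_congr rfl fun i _ => ?_
  rw [Finset.sum_comm]

theorem hsNormSq_eq_sum_sliceRight (z : Matrix (ι × κ) (ι × κ) ℂ) :
    hsNormSq z = ∑ k, ∑ l, hsNormSq (sliceRight k l z) := by
  simp only [hsNormSq, Fintype.sum_prod_type, sliceRight_apply]
  rw [Finset.sum_comm]
  refine Finset.sum_congr rfl fun k _ => ?_
  rw [Finset.sum_comm_cycle, Finset.sum_congr rfl]
  exact fun l _ => Finset.sum_comm

theorem hsNormSq_mapLeft_le (h : ∀ y, hsNormSq (E₂ y) ≤ hsNormSq y)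
    (z : Matrix (ι × κ) (ι × κ) ℂ) : hsNormSq (mapLeft E₂ z) ≤ hsNormSq z := by
  rw [hsNormSq_eq_sum_sliceLeft, hsNormSq_eq_sum_sliceLeft z]
  simp only [sliceLeft_mapLeft]
  exact Finset.sum_le_sum fun i _ => Finset.sum_le_sum fun j _ => h _

theorem hsNormSq_mapRight_le (h : ∀ x, hsNormSq (E₁ x) ≤ hsNormSq x)
    (z : Matrix (ι × κ) (ι × κ) ℂ) : hsNormSq (mapRight E₁ z) ≤ hsNormSq z := by
  rw [hsNormSq_eq_sum_sliceRight, hsNormSq_eq_sum_sliceRight z]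
  simp only [sliceRight_mapRight]
  exact Finset.sum_le_sum fun i _ => Finset.sum_le_sum fun j _ => h _

theorem hsNormSq_map_sliceLeft (h : ∀ y, hsNormSq (E₂ y) ≤ hsNormSq y)
    {z : Matrix (ι × κ) (ι × κ) ℂ} (hz : hsNormSq (mapLeft E₂ z) = hsNormSq z) (i j : ι) :
    hsNormSq (E₂ (sliceLeft i j z)) = hsNormSq (sliceLeft i j z) := by
  rw [hsNormSq_eq_sum_sliceLeft, hsNormSq_eq_sum_sliceLeft z] at hz
  simp only [sliceLeft_mapLeft] at hz
  have hi := (Finset.sum_eq_sum_iff_of_le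
    fun i _ => Finset.sum_le_sum fun j _ => h (sliceLeft i j z)).1 hz i (Finset.mem_univ i)
  exact (Finset.sum_eq_sum_iff_of_le fun j _ => h _).1 hi j (Finset.mem_univ j)

theorem hsNormSq_map_sliceRight (h : ∀ x, hsNormSq (E₁ x) ≤ hsNormSq x)
    {z : Matrix (ι × κ) (ι × κ) ℂ} (hz : hsNormSq (mapRight E₁ z) = hsNormSq z) (k l : κ) :
    hsNormSq (E₁ (sliceRight k l z)) = hsNormSq (sliceRight k l z) := by
  rw [hsNormSq_eq_sum_sliceRight, hsNormSq_eq_sum_sliceRight z] at hz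
  simp only [sliceRight_mapRight] at hz
  have hk := (Finset.sum_eq_sum_iff_of_le
    fun k _ => Finset.sum_le_sum fun l _ => h (sliceRight k l z)).1 hz k (Finset.mem_univ k)
  exact (Finset.sum_eq_sum_iff_of_le fun l _ => h _).1 hk l (Finset.mem_univ l)

end Norm

section Tensor

variable [DecidableEq ι] {E₁ : Module.End ℂ (Matrix ι ι ℂ)} {E₂ : Module.End ℂ (Matrix κ κ ℂ)}
  {F : Module.End ℂ (Matrix (ι × κ) (ι × κ) ℂ)}

theorem trace_map_of_kronecker (hF : ∀ x y, F (x ⊗ₖ y) = E₁ x ⊗ₖ E₂ y)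
    (h₁ : IsQuantumChannel E₁) (h₂ : IsQuantumChannel E₂) (z : Matrix (ι × κ) (ι × κ) ℂ) :
    (F z).trace = z.trace := by
  induction z using kronecker_induction with
  | add x y hx hy => simp only [map_add, Matrix.trace_add, hx, hy]
  | zero => simp
  | kronecker x y => simp only [hF, Matrix.trace_kronecker, h₁.2, h₂.2]

variable [DecidableEq κ]

theorem map_conjTranspose_of_kronecker (hF : ∀ x y, F (x ⊗ₖ y) = E₁ x ⊗ₖ E₂ y)
    (h₁ : IsQuantumChannel E₁) (h₂ : IsQuantumChannel E₂) (z : Matrix (ι × κ) (ι × κ) ℂ) :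
    F zᴴ = (F z)ᴴ := by
  induction z using kronecker_induction with
  | add x y hx hy => simp only [Matrix.conjTranspose_add, map_add, hx, hy]
  | zero => simp
  | kronecker x y =>
    simp only [Matrix.conjTranspose_kronecker, hF, h₁.map_conjTranspose, h₂.map_conjTranspose]

theorem kronecker_mem_multDomain (hF : ∀ x y, F (x ⊗ₖ y) = E₁ x ⊗ₖ E₂ y)
    {a : Matrix ι ι ℂ} (ha : a ∈ multDomain E₁) {b : Matrix κ κ ℂ} (hb : b ∈ multDomain E₂) :
    a ⊗ₖ b ∈ multDomain F := by
  intro z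
  induction z using kronecker_induction with
  | add x y hx hy => simp only [mul_add, add_mul, map_add, hx.1, hx.2, hy.1, hy.2, and_self]
  | zero => simp
  | kronecker x y =>
    simp only [← Matrix.mul_kronecker_mul, hF, (ha x).1, (ha x).2, (hb y).1, (hb y).2, and_self]

end Tensor

end MultiplicativeDomain

/-- For unital quantum channels `E₁, E₂`, the multiplicative domain of
their tensor product (the channel `F` with `F (x ⊗ₖ y) = E₁ x ⊗ₖ E₂ y`) is the tensor
product of the multiplicative domains, i.e. the span of `{a ⊗ₖ b | a ∈ M_{E₁}, b ∈ M_{E₂}}`. -/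
theorem stmt1 (d d' : ℕ)
    (E₁ : Module.End ℂ (Matrix (Fin d) (Fin d) ℂ))
    (E₂ : Module.End ℂ (Matrix (Fin d') (Fin d') ℂ))
    (h₁ : IsQuantumChannel E₁) (hu₁ : E₁ 1 = 1)
    (h₂ : IsQuantumChannel E₂) (hu₂ : E₂ 1 = 1)
    (F : Module.End ℂ (Matrix (Fin d × Fin d') (Fin d × Fin d') ℂ))
    (hF : ∀ (x : Matrix (Fin d) (Fin d) ℂ) (y : Matrix (Fin d') (Fin d') ℂ),
      F (x ⊗ₖ y) = E₁ x ⊗ₖ E₂ y) :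
    multDomain F =
      SetLike.coe (Submodule.span ℂ
        {z | ∃ a ∈ multDomain E₁, ∃ b ∈ multDomain E₂, z = a ⊗ₖ b}) := by
  have hc₁ := h₁.hsNormSq_map_le hu₁
  have hc₂ := h₂.hsNormSq_map_le hu₂
  apply Set.Subset.antisymm
  · intro z hz
    have hiso : hsNormSq (F z) = hsNormSq z := by
      have := congrArg Matrix.trace (hz z.conjTranspose).2
      rw [trace_map_of_kronecker hF h₁ h₂, map_conjTranspose_of_kronecker hF h₁ h₂,
        trace_conjTranspose_mul_self, trace_conjTranspose_mul_self] at this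
      exact_mod_cast this.symm
    have hl : hsNormSq (mapLeft E₂ z) = hsNormSq z := by
      refine (hsNormSq_mapLeft_le hc₂ z).antisymm ?_
      rw [← hiso, eq_mapRight_mapLeft hF]
      exact hsNormSq_mapRight_le hc₁ _
    have hr : hsNormSq (mapRight E₁ z) = hsNormSq z := by
      refine (hsNormSq_mapRight_le hc₁ z).antisymm ?_
      rw [← hiso, eq_mapLeft_mapRight hF]
      exact hsNormSq_mapLeft_le hc₂ _
    exact mem_span_kronecker_of_slices (S := multDomainSubmodule E₁)
      (T := multDomainSubmodule E₂)
      (fun k l => h₁.mem_multDomain hu₁ (hsNormSq_map_sliceRight hc₁ hr k l))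
      (fun i j => h₂.mem_multDomain hu₂ (hsNormSq_map_sliceLeft hc₂ hl i j))
  · refine (Submodule.span_le (p := multDomainSubmodule F)).2 ?_
    rintro _ ⟨a, ha, b, hb, rfl⟩
    exact kronecker_mem_multDomain hF ha hb
end
end

section
/- If A is a maximal unital proper *-subalgebra (MUPSA) of M_d, then A is *-isomorphic to M_{d−r} ⊕ M_r for some integer r with 1 ≤ r ≤ d−1. -/
noncomputable section

/-- `A` is a maximal unital proper *-subalgebra (MUPSA) of the C*-algebra `B`. -/
def IsMUPSAOf {B : Type*} [Semiring B] [StarRing B] [Algebra ℂ B] [StarModule ℂ B]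
    (A C : StarSubalgebra ℂ B) : Prop :=
  A ≤ C ∧ A ≠ C ∧ ∀ D : StarSubalgebra ℂ B, A ≤ D → D ≤ C → D = A ∨ D = C

open Matrix

section AdjointClosed

variable {V : Type*} [NormedAddCommGroup V] [InnerProductSpace ℂ V] [FiniteDimensional ℂ V]

theorem isSemisimpleModule_of_adjoint_mem (B : Subalgebra ℂ (Module.End ℂ V))
    (hB : ∀ b ∈ B, LinearMap.adjoint b ∈ B) : IsSemisimpleModule B V := by
  refine (isSemisimpleModule_iff B V).2 ⟨fun W => ?_⟩
  let W₀ : Submodule ℂ V := W.restrictScalars ℂ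
  let W' : Submodule B V :=
    { carrier := W₀ᗮ
      add_mem' := fun ha hb => W₀ᗮ.add_mem ha hb
      zero_mem' := W₀ᗮ.zero_mem
      smul_mem' := by
        intro c x hx u hu
        change inner ℂ u (c.1 x) = 0
        rw [← LinearMap.adjoint_inner_left]
        exact hx _ (W.smul_mem (⟨_, hB c.1 c.2⟩ : B) hu) }
  have h : IsCompl W₀ W₀ᗮ := W₀.isCompl_orthogonal
  refine ⟨W', ?_, ?_⟩
  · rw [Submodule.disjoint_def]
    exact fun x hx hx' => (Submodule.disjoint_def.1 h.disjoint) x hx hx'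
  · rw [Submodule.codisjoint_iff_exists_add_eq]
    exact fun z => (Submodule.codisjoint_iff_exists_add_eq.1 h.codisjoint) z

theorem eq_top_of_commutant_scalar (B : Subalgebra ℂ (Module.End ℂ V))
    (hB : ∀ b ∈ B, LinearMap.adjoint b ∈ B)
    (hc : ∀ g : Module.End ℂ V, (∀ b ∈ B, Commute b g) → ∃ z : ℂ, g = z • 1) : B = ⊤ := by
  have := isSemisimpleModule_of_adjoint_mem B hB
  refine eq_top_iff.2 fun f _ => ?_
  let F : Module.End (Module.End B V) V :=
    { toFun := f
      map_add' := f.map_add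
      map_smul' := fun g x => by
        obtain ⟨z, hz⟩ := hc (g.restrictScalars ℂ) fun b hb => by
          ext x
          exact (g.map_smul (⟨b, hb⟩ : B) x).symm
        have h : ∀ y, g y = z • y := fun y => by
          simpa using congrArg (fun k : Module.End ℂ V => k y) hz
        simp [h] }
  classical
  let v := Module.finBasis ℂ V
  obtain ⟨r, hr⟩ := jacobson_density F (Finset.univ.image v)
  have : f = r.1 := v.ext fun i => hr _ (Finset.mem_image_of_mem _ (Finset.mem_univ i))
  exact this ▸ r.2

end AdjointClosed

theorem exists_not_scalar {d : ℕ} (A : StarSubalgebra ℂ (Matrix (Fin d) (Fin d) ℂ)) (hA : A ≠ ⊤) :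
    ∃ h : Matrix (Fin d) (Fin d) ℂ, h.IsHermitian ∧ (∀ a ∈ A, Commute a h) ∧ ∀ z : ℂ, h ≠ z • 1 := by
  by_contra! H
  apply hA
  have key : ∀ g : Matrix (Fin d) (Fin d) ℂ, (∀ a ∈ A, Commute a g) → ∃ z : ℂ, g = z • 1 := by
    intro g hg
    have hg' : ∀ a ∈ A, Commute a (star g) := fun a ha => by
      have := (hg (star a) (star_mem ha)).star_star
      simpa using this
    obtain ⟨z, hz⟩ := H (realPart g : Matrix _ _ ℂ) (realPart g).2 fun a ha => by
      rw [realPart_apply_coe]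
      exact ((hg a ha).add_right (hg' a ha)).smul_right _
    obtain ⟨w, hw⟩ := H (imaginaryPart g : Matrix _ _ ℂ) (imaginaryPart g).2 fun a ha => by
      rw [imaginaryPart_apply_coe]
      exact (((hg a ha).sub_right (hg' a ha)).smul_right _).smul_right _
    refine ⟨z + Complex.I * w, ?_⟩
    rw [← realPart_add_I_smul_imaginaryPart g, hz, hw, add_smul, mul_smul]
  let Φ := Matrix.toLinAlgEquiv (EuclideanSpace.basisFun (Fin d) ℂ).toBasis
  have hadj : ∀ a, LinearMap.adjoint (Φ a) = Φ (star a) := fun a =>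
    (Matrix.toLin_conjTranspose _ _ a).symm
  have := eq_top_of_commutant_scalar (A.toSubalgebra.map Φ.toAlgHom) (by
      rintro _ ⟨a, ha, rfl⟩
      exact ⟨star a, star_mem (s := A) ha, (hadj a).symm⟩) (by
      intro g hg
      obtain ⟨z, hz⟩ := key (Φ.symm g) fun a ha => by
        have := (hg _ ⟨a, ha, rfl⟩).map Φ.symm
        simpa using this
      refine ⟨z, ?_⟩
      rw [← Φ.apply_symm_apply g, hz]; simp)
  refine eq_top_iff.2 fun x _ => ?_
  obtain ⟨a, ha, hax⟩ : Φ x ∈ A.toSubalgebra.map Φ.toAlgHom := this ▸ Algebra.mem_top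
  rwa [← Φ.injective hax]

/-- The embedding of `M_m ⊕ M_l` into `M_n` as block-diagonal matrices, along `e : m ⊕ l ≃ n`. -/
def blockHom {n m l : Type*} [Fintype n] [Fintype m] [Fintype l] [DecidableEq n] [DecidableEq m]
    [DecidableEq l] (e : m ⊕ l ≃ n) :
    (Matrix m m ℂ × Matrix l l ℂ) →⋆ₐ[ℂ] Matrix n n ℂ where
  toFun x := reindex e e (fromBlocks x.1 0 0 x.2)
  map_one' := by simp
  map_mul' x y := by simp [fromBlocks_multiply]
  map_zero' := by simp
  map_add' x y := by
    ext i j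
    rcases h : e.symm i with k | k <;> rcases h' : e.symm j with l | l <;> simp [h, h']
  commutes' z := by
    ext i j
    rcases h : e.symm i with k | k <;> rcases h' : e.symm j with l | l <;>
      simp [h, h', algebraMap_matrix_apply, ← e.symm.injective.eq_iff (a := i)]
  map_star' x := by simp [star_eq_conjTranspose, fromBlocks_conjTranspose]

theorem blockHom_injective {n m l : Type*} [Fintype n] [Fintype m] [Fintype l] [DecidableEq n]
    [DecidableEq m] [DecidableEq l] (e : m ⊕ l ≃ n) : Function.Injective (blockHom e) := by
  intro x y h
  have := (reindex e e).injective h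
  rw [fromBlocks_inj] at this
  exact Prod.ext this.1 this.2.2.2

theorem mem_range_blockHom {n m l : Type*} [Fintype n] [Fintype m] [Fintype l] [DecidableEq n]
    [DecidableEq m] [DecidableEq l] (e : m ⊕ l ≃ n) (x : Matrix n n ℂ) :
    x ∈ (blockHom e).range ↔
      ∀ i j, x (e (.inl i)) (e (.inr j)) = 0 ∧ x (e (.inr j)) (e (.inl i)) = 0 := by
  constructor
  · rintro ⟨y, rfl⟩ i j
    simp [blockHom]
  · intro h
    refine ⟨⟨(x.submatrix e e).toBlocks₁₁, (x.submatrix e e).toBlocks₂₂⟩, ?_⟩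
    refine (reindex e e).symm.injective ?_
    ext (i | i) (j | j) <;> simp [blockHom, toBlocks₁₁, toBlocks₂₂, h]

theorem exists_blockHom_of_isHermitian {d : ℕ} {h : Matrix (Fin d) (Fin d) ℂ}
    (hh : h.IsHermitian) (hs : ∀ z : ℂ, h ≠ z • 1) :
    ∃ r : ℕ, 1 ≤ r ∧ r ≤ d - 1 ∧
      ∃ φ : (Matrix (Fin (d - r)) (Fin (d - r)) ℂ × Matrix (Fin r) (Fin r) ℂ) →⋆ₐ[ℂ]
          Matrix (Fin d) (Fin d) ℂ,
        Function.Injective φ ∧ φ.range ≠ ⊤ ∧ ∀ a, Commute a h → a ∈ φ.range := by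
  classical
  let c := Unitary.conjStarAlgAut ℂ (Matrix (Fin d) (Fin d) ℂ) hh.eigenvectorUnitary
  have hc : h = c (diagonal (RCLike.ofReal ∘ hh.eigenvalues)) := hh.spectral_theorem
  obtain ⟨i₀, j₀, hij⟩ : ∃ i j, hh.eigenvalues j ≠ hh.eigenvalues i := by
    by_contra! H
    rcases isEmpty_or_nonempty (Fin d) with hd | ⟨⟨i⟩⟩
    · exact hs 0 (Subsingleton.elim _ _)
    · refine hs (hh.eigenvalues i) ?_
      have : diagonal (RCLike.ofReal ∘ hh.eigenvalues) =
          (hh.eigenvalues i : ℂ) • (1 : Matrix (Fin d) (Fin d) ℂ) := by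
        rw [smul_one_eq_diagonal]
        congr 1
        ext j
        simp [H i j]
      rw [this, map_smul, map_one] at hc
      exact hc
  let p : Fin d → Prop := fun i => hh.eigenvalues i = hh.eigenvalues i₀
  let r := Fintype.card {i // ¬ p i}
  have hr : 1 ≤ r := Fintype.card_pos_iff.2 ⟨⟨j₀, hij⟩⟩
  have hr' : 1 ≤ Fintype.card {i // p i} := Fintype.card_pos_iff.2 ⟨⟨i₀, rfl⟩⟩
  have hsum : Fintype.card {i // p i} + r = d := by
    have := Fintype.card_congr (Equiv.sumCompl p)
    rwa [Fintype.card_sum, Fintype.card_fin] at this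
  let e₁ : Fin (d - r) ≃ {i // p i} := (Fintype.equivFinOfCardEq (by omega)).symm
  let e₂ : Fin r ≃ {i // ¬ p i} := (Fintype.equivFin _).symm
  let e : Fin (d - r) ⊕ Fin r ≃ Fin d := (Equiv.sumCongr e₁ e₂).trans (Equiv.sumCompl p)
  have he₁ : ∀ i, e (.inl i) = e₁ i := fun i => by simp [e]
  have he₂ : ∀ i, e (.inr i) = e₂ i := fun i => by simp [e]
  let φ := (c : Matrix (Fin d) (Fin d) ℂ →⋆ₐ[ℂ] Matrix (Fin d) (Fin d) ℂ).comp (blockHom e)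
  have hφ : ∀ y, φ y = c (blockHom e y) := fun _ => rfl
  refine ⟨r, hr, by omega, φ, fun x y hxy => blockHom_injective e (EquivLike.injective c hxy),
    fun htop => ?_, fun a ha => ?_⟩
  · obtain ⟨y, hy⟩ : c (of fun _ _ => 1) ∈ φ.range :=
      htop ▸ StarSubalgebra.mem_top
    have hy' : blockHom e y = of fun _ _ => 1 := EquivLike.injective c hy
    have := ((mem_range_blockHom e _).1 ⟨y, hy'⟩ (e₁.symm ⟨i₀, rfl⟩) (e₂.symm ⟨j₀, hij⟩)).1
    simp at this
  · have hcomm : Commute (c.symm a) (diagonal (RCLike.ofReal ∘ hh.eigenvalues)) := by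
      have := ha.map c.symm
      rwa [hc, c.symm_apply_apply] at this
    have hzero : ∀ i j, hh.eigenvalues i ≠ hh.eigenvalues j → c.symm a i j = 0 := by
      intro i j hne
      have := congrFun (congrFun hcomm.eq i) j
      rw [mul_diagonal, diagonal_mul, mul_comm, ← sub_eq_zero, ← sub_mul] at this
      refine (mul_eq_zero.1 this).resolve_left fun h0 => hne ?_
      exact Complex.ofReal_injective (sub_eq_zero.1 h0).symm
    have hmem : c.symm a ∈ (blockHom e).range := by
      rw [mem_range_blockHom]
      intro i j
      rw [he₁, he₂]
      have h₁ : hh.eigenvalues (e₁ i) = hh.eigenvalues i₀ := (e₁ i).2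
      have h₂ : hh.eigenvalues (e₂ j) ≠ hh.eigenvalues i₀ := (e₂ j).2
      exact ⟨hzero _ _ (h₁ ▸ h₂.symm), hzero _ _ (h₁ ▸ h₂)⟩
    obtain ⟨y, hy⟩ := hmem
    refine ⟨y, ?_⟩
    have hy' : blockHom e y = c.symm a := hy
    change φ y = a
    rw [hφ, hy']
    exact c.apply_symm_apply a

/-- A maximal unital proper *-subalgebra of `M_d` is *-isomorphic to
`M_{d-r} ⊕ M_r` for some `1 ≤ r ≤ d - 1`. -/
theorem stmt9 (d : ℕ) (A : StarSubalgebra ℂ (Matrix (Fin d) (Fin d) ℂ))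
    (hA : IsMUPSAOf A ⊤) :
    ∃ r : ℕ, 1 ≤ r ∧ r ≤ d - 1 ∧
      Nonempty (A ≃⋆ₐ[ℂ]
        (Matrix (Fin (d - r)) (Fin (d - r)) ℂ × Matrix (Fin r) (Fin r) ℂ)) := by
  obtain ⟨-, hne, hmax⟩ := hA
  obtain ⟨h, hh, hcomm, hs⟩ := exists_not_scalar A hne
  obtain ⟨r, hr, hr', φ, hφ, htop, hmem⟩ := exists_blockHom_of_isHermitian hh hs
  have hrange : φ.range = A :=
    (hmax φ.range (fun a ha => hmem a (hcomm a ha)) le_top).resolve_right htop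
  subst hrange
  exact ⟨r, hr, hr', ⟨(StarAlgEquiv.ofInjective φ hφ).symm⟩⟩
end
end

section
/- Let {φ_i}_{i=1}^d and {ζ_i}_{i=1}^d be orthonormal bases of ℂ^d and let E : M_d → M_d be the quantum channel E(x) = Σ_{i=1}^d φ_i ζ_i* x ζ_i φ_i* (which is unital and trace preserving). Then the multiplicative domain of E is M_E = span{ζ_i ζ_i* : 1 ≤ i ≤ d}, the maximal abelian subalgebra of matrices diagonal in the basis {ζ_i}. -/
open scoped Kronecker ComplexOrder

noncomputable section

/-- The matrix with orthonormal columns `v i` has `Uᴴ * U = 1`. -/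
lemma conjTranspose_transpose_of_mul_self {d : ℕ} (v : Fin d → (Fin d → ℂ))
    (hv : ∀ i j, (∑ a, star (v i a) * v j a) = if i = j then (1 : ℂ) else 0) :
    (Matrix.of v).transpose.conjTranspose * (Matrix.of v).transpose = 1 := by
  ext i j
  simpa [Matrix.mul_apply, Matrix.one_apply] using hv i j

/-- A diagonal matrix in the basis given by the columns `v i`, as a combination of rank-one
matrices. -/
lemma mul_diagonal_mul_conjTranspose_eq_sum {d : ℕ} (v : Fin d → (Fin d → ℂ)) (c : Fin d → ℂ) :
    (Matrix.of v).transpose * Matrix.diagonal c * (Matrix.of v).transpose.conjTranspose =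
      ∑ i, c i • Matrix.vecMulVec (v i) (star (v i)) := by
  ext a b
  rw [Matrix.mul_apply]
  simp only [Matrix.mul_diagonal, Matrix.sum_apply, Matrix.smul_apply,
    Matrix.vecMulVec_apply, Matrix.transpose_apply, Matrix.conjTranspose_apply, Matrix.of_apply,
    Pi.star_apply, smul_eq_mul]
  exact Finset.sum_congr rfl fun i _ => by ring

/-- Conjugating by `U` and then by `Uᴴ` is the identity when `Uᴴ * U = 1`. -/
lemma conjTranspose_mul_conj_mul {d : ℕ} {U : Matrix (Fin d) (Fin d) ℂ}
    (hU : U.conjTranspose * U = 1) (D : Matrix (Fin d) (Fin d) ℂ) :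
    U.conjTranspose * (U * D * U.conjTranspose) * U = D := by
  calc _ = (U.conjTranspose * U) * D * (U.conjTranspose * U) := by simp only [Matrix.mul_assoc]
    _ = D := by rw [hU, one_mul, mul_one]

/-- Sandwiching `x` between rank-one matrices. -/
lemma vecMulVec_mul_mul_vecMulVec {d : ℕ} (u w : Fin d → ℂ) (x : Matrix (Fin d) (Fin d) ℂ) :
    Matrix.vecMulVec u (star w) * x * Matrix.vecMulVec w (star u) =
      (star w ⬝ᵥ (x.mulVec w)) • Matrix.vecMulVec u (star u) := by
  rw [Matrix.mul_assoc, Matrix.mul_vecMulVec, Matrix.vecMulVec_mul_vecMulVec]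
  ext a b
  simp only [Matrix.vecMulVec_apply, Matrix.smul_apply, Pi.smul_apply, smul_eq_mul]
  ring

/-- The diagonal entries of `x` in the basis `v`. -/
lemma conj_apply_eq_dotProduct {d : ℕ} (v : Fin d → (Fin d → ℂ)) (x : Matrix (Fin d) (Fin d) ℂ)
    (i : Fin d) :
    ((Matrix.of v).transpose.conjTranspose * x * (Matrix.of v).transpose) i i =
      star (v i) ⬝ᵥ (x.mulVec (v i)) := by
  rw [Matrix.mul_assoc]
  simp [Matrix.mul_apply, dotProduct, Matrix.mulVec]

/-- For orthonormal bases `{φ i}` and `{ζ i}` of `ℂ^d`, the channel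
`E x = ∑ i, (φ i ζ i*) x (ζ i φ i*)` has multiplicative domain equal to
`span {ζ i ζ i* : i}`, the algebra of matrices diagonal in the basis `{ζ i}`. -/
theorem stmt14 (d : ℕ) (φ ζ : Fin d → (Fin d → ℂ))
    (hφ : ∀ i j, (∑ a, star (φ i a) * φ j a) = if i = j then (1 : ℂ) else 0)
    (hζ : ∀ i j, (∑ a, star (ζ i a) * ζ j a) = if i = j then (1 : ℂ) else 0)
    (E : Module.End ℂ (Matrix (Fin d) (Fin d) ℂ))
    (hE : ∀ x, E x = ∑ i, Matrix.vecMulVec (φ i) (star (ζ i)) * x *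
      Matrix.vecMulVec (ζ i) (star (φ i))) :
    multDomain E =
      SetLike.coe (Submodule.span ℂ
        (Set.range fun i => Matrix.vecMulVec (ζ i) (star (ζ i)))) := by
  set U := (Matrix.of ζ).transpose with hU
  set V := (Matrix.of φ).transpose with hV
  have hUU : U.conjTranspose * U = 1 := conjTranspose_transpose_of_mul_self ζ hζ
  have hVV : V.conjTranspose * V = 1 := conjTranspose_transpose_of_mul_self φ hφ
  have hUU' : U * U.conjTranspose = 1 := mul_eq_one_comm.mp hUU
  have hform : ∀ x, E x =
      V * Matrix.diagonal (fun i => (U.conjTranspose * x * U) i i) * V.conjTranspose := by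
    intro x
    rw [hE, hV, mul_diagonal_mul_conjTranspose_eq_sum]
    exact Finset.sum_congr rfl fun i _ => by
      rw [vecMulVec_mul_mul_vecMulVec, hU, conj_apply_eq_dotProduct]
  have hdiag : ∀ x, V.conjTranspose * E x * V =
      Matrix.diagonal (fun i => (U.conjTranspose * x * U) i i) := by
    intro x
    rw [hform, conjTranspose_mul_conj_mul hVV]
  have hEmul : ∀ x y, E x * E y = V * Matrix.diagonal (fun i => (U.conjTranspose * x * U) i i *
      (U.conjTranspose * y * U) i i) * V.conjTranspose := by
    intro x y
    rw [← Matrix.diagonal_mul_diagonal, ← hdiag y, hform x]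
    have hVV' : V * V.conjTranspose = 1 := mul_eq_one_comm.mp hVV
    simp only [Matrix.mul_assoc, hVV', mul_one]
  have hconj : ∀ x y, U.conjTranspose * (x * y) * U =
      (U.conjTranspose * x * U) * (U.conjTranspose * y * U) := by
    intro x y
    calc _ = U.conjTranspose * x * 1 * y * U := by simp only [Matrix.mul_assoc, one_mul]
      _ = _ := by rw [← hUU']; simp only [Matrix.mul_assoc]
  ext x
  constructor
  · intro hx
    have hoff : U.conjTranspose * x * U =
        Matrix.diagonal (fun i => (U.conjTranspose * x * U) i i) := by
      ext i j
      rcases eq_or_ne i j with rfl | hij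
      · simp
      rw [Matrix.diagonal_apply_ne _ hij]
      have h := congrArg (fun z => (V.conjTranspose * z * V) i i)
        (hx (U * Matrix.single j i 1 * U.conjTranspose)).1
      simp only [hEmul] at h
      rw [hdiag, conjTranspose_mul_conj_mul hVV, hconj, conjTranspose_mul_conj_mul hUU] at h
      simpa [hij.symm] using h
    have hxU : x = U * Matrix.diagonal (fun i => (U.conjTranspose * x * U) i i) *
        U.conjTranspose := by
      rw [← hoff]
      calc x = (U * U.conjTranspose) * x * (U * U.conjTranspose) := by rw [hUU', one_mul, mul_one]
        _ = _ := by simp only [Matrix.mul_assoc]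
    rw [hxU, hU, mul_diagonal_mul_conjTranspose_eq_sum]
    exact Submodule.sum_mem _ fun i _ =>
      Submodule.smul_mem _ _ (Submodule.subset_span ⟨i, rfl⟩)
  · intro hx
    obtain ⟨c, rfl⟩ := (Submodule.mem_span_range_iff_exists_fun ℂ).mp hx
    rw [← mul_diagonal_mul_conjTranspose_eq_sum, ← hU]
    have hX : U.conjTranspose * (U * Matrix.diagonal c * U.conjTranspose) * U =
        Matrix.diagonal c := conjTranspose_mul_conj_mul hUU _
    intro y
    constructor
    · rw [hEmul, hform, hconj, hX]
      simp
    · rw [hEmul, hform, hconj, hX]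
      simp
end
end

section
/- Let {φ_i}_{i=1}^d and {ζ_i}_{i=1}^d be orthonormal bases of ℂ^d and let E : M_d → M_d be the unital entanglement breaking channel E(x) = Σ_{i=1}^d φ_i ζ_i* x ζ_i φ_i*. Then for every 1 ≤ r ≤ d and every projection p ∈ M_d, p belongs to M_{E^r} if and only if there exist subsets K₁, …, K_r of {1, …, d}, each of cardinality rank(p), such that Σ_{k∈K₁} ζ_k ζ_k* = p and Σ_{k∈K_i} φ_k φ_k* = Σ_{k∈K_{i+1}} ζ_k ζ_k* for all 1 ≤ i ≤ r−1. -/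
open scoped Kronecker ComplexOrder

noncomputable section

namespace DiagonalCompression

open Matrix

variable {ι : Type*} [Fintype ι]

/-- The squared Frobenius norm of a complex matrix. -/
def frobSq (x : Matrix ι ι ℂ) : ℝ := ∑ i, ∑ j, ‖x i j‖ ^ 2

theorem ofReal_frobSq (x : Matrix ι ι ℂ) : (frobSq x : ℂ) = (star x * x).trace := by
  simp only [frobSq, trace, diag_apply, mul_apply, star_apply, RCLike.star_def, RCLike.conj_mul]
  rw [Finset.sum_comm]
  push_cast
  rfl

variable [DecidableEq ι]

theorem frobSq_conj (U x : Matrix ι ι ℂ) (hU : star U * U = 1) :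
    frobSq (U * x * star U) = frobSq x := by
  have h : (frobSq (U * x * star U) : ℂ) = frobSq x := by
    rw [ofReal_frobSq, ofReal_frobSq]
    have : star (U * x * star U) * (U * x * star U) =
        U * (star x * (star U * U) * x * star U) := by
      simp only [star_mul, star_star, Matrix.mul_assoc]
    rw [this, trace_mul_comm, hU, Matrix.mul_one, Matrix.mul_assoc, hU, Matrix.mul_one]
  exact_mod_cast h

theorem frobSq_diagonal_diag_le (x : Matrix ι ι ℂ) :
    frobSq (diagonal x.diag) ≤ frobSq x := by
  refine Finset.sum_le_sum fun i _ => Finset.sum_le_sum fun j _ => ?_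
  by_cases h : i = j
  · subst h; simp
  · simp [h]

theorem eq_diagonal_of_frobSq_le (x : Matrix ι ι ℂ)
    (h : frobSq x ≤ frobSq (diagonal x.diag)) : x = diagonal x.diag := by
  have hle : ∀ i j, ‖diagonal x.diag i j‖ ^ 2 ≤ ‖x i j‖ ^ 2 := fun i j => by
    by_cases h : i = j
    · subst h; simp
    · simp [h]
  have heq := le_antisymm (frobSq_diagonal_diag_le x) h
  unfold frobSq at heq
  rw [Finset.sum_eq_sum_iff_of_le fun i _ => Finset.sum_le_sum fun j _ => hle i j] at heq
  ext i j
  have hij := (Finset.sum_eq_sum_iff_of_le fun j _ => hle i j).1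
    (heq i (Finset.mem_univ i)) j (Finset.mem_univ j)
  by_cases hne : i = j
  · subst hne; simp
  · simpa [hne, eq_comm] using hij

/-- The diagonal projection onto the coordinates in `K`. -/
def coordProj (K : Finset ι) : Matrix ι ι ℂ := diagonal fun i => if i ∈ K then 1 else 0

theorem trace_coordProj (K : Finset ι) : (coordProj K).trace = K.card := by
  simp [coordProj]

theorem coordProj_mul_self (K : Finset ι) : coordProj K * coordProj K = coordProj K := by
  simp [coordProj]

theorem exists_diagonal_eq_coordProj (w : ι → ℂ)
    (hw : diagonal w * diagonal w = diagonal w) : ∃ K, diagonal w = coordProj K := by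
  rw [diagonal_mul_diagonal, diagonal_eq_diagonal_iff] at hw
  refine ⟨Finset.univ.filter fun i => w i = 1, ?_⟩
  rw [coordProj, diagonal_eq_diagonal_iff]
  intro i
  by_cases h : w i = 1
  · simp [h]
  · have h0 : w i = 0 := by
      by_contra h0
      exact h (mul_left_cancel₀ h0 (by simpa using hw i))
    simp [h0]

theorem diag_coordProj_mul (K : Finset ι) (x : Matrix ι ι ℂ) :
    diagonal (coordProj K * x).diag = coordProj K * diagonal x.diag := by
  rw [coordProj, diagonal_mul_diagonal]
  congr 1
  ext i
  simp [diagonal_mul]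

theorem diag_mul_coordProj (K : Finset ι) (x : Matrix ι ι ℂ) :
    diagonal (x * coordProj K).diag = diagonal x.diag * coordProj K := by
  rw [coordProj, diagonal_mul_diagonal]
  congr 1
  ext i
  simp [mul_diagonal]

theorem conj_mul_self (U x : Matrix ι ι ℂ) (hU : star U * U = 1) (hx : x * x = x) :
    (U * x * star U) * (U * x * star U) = U * x * star U := by
  have : (U * x * star U) * (U * x * star U) = U * (x * (star U * U) * x) * star U := by
    simp only [Matrix.mul_assoc]
  rw [this, hU, Matrix.mul_one, hx]

theorem sum_vecMulVec_eq (v : ι → ι → ℂ) (K : Finset ι) :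
    ∑ k ∈ K, vecMulVec (v k) (star (v k)) =
      (of v)ᵀ * coordProj K * star (of v)ᵀ := by
  ext a b
  rw [coordProj, mul_apply]
  simp [Matrix.sum_apply, vecMulVec_apply, mul_diagonal]

theorem trace_eq_rank_of_mul_self (p : Matrix ι ι ℂ) (hp : p * p = p) :
    p.trace = p.rank := by
  have hid : IsIdempotentElem (toLin' p) := by
    rw [IsIdempotentElem, Module.End.mul_eq_comp, ← toLin'_mul, hp]
  have := (LinearMap.IsIdempotentElem.isProj_range _ hid).trace
  rw [Matrix.trace_toLin'_eq] at this
  rw [this]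
  rfl

section Channel

variable {U V : Matrix ι ι ℂ} {E : Module.End ℂ (Matrix ι ι ℂ)}

theorem frobSq_apply_le (hU : star U * U = 1) (hV : star V * V = 1)
    (hE : ∀ x, E x = V * diagonal (star U * x * U).diag * star V) (x : Matrix ι ι ℂ) :
    frobSq (E x) ≤ frobSq x := by
  rw [hE, frobSq_conj _ _ hV]
  refine (frobSq_diagonal_diag_le _).trans_eq ?_
  simpa using frobSq_conj (star U) x (by simpa using mul_eq_one_comm.1 hU)

theorem frobSq_pow_apply_le (hU : star U * U = 1) (hV : star V * V = 1)
    (hE : ∀ x, E x = V * diagonal (star U * x * U).diag * star V) (r : ℕ) (x : Matrix ι ι ℂ) :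
    frobSq ((E ^ r) x) ≤ frobSq x := by
  induction r with
  | zero => simp
  | succ r ih =>
    rw [pow_succ', Module.End.mul_apply]
    exact (frobSq_apply_le hU hV hE _).trans ih

theorem trace_pow_apply (hU : star U * U = 1) (hV : star V * V = 1)
    (hE : ∀ x, E x = V * diagonal (star U * x * U).diag * star V) (r : ℕ) (x : Matrix ι ι ℂ) :
    ((E ^ r) x).trace = x.trace := by
  induction r with
  | zero => simp
  | succ r ih =>
    rw [pow_succ', Module.End.mul_apply, hE, trace_mul_comm, ← Matrix.mul_assoc, hV,
      Matrix.one_mul, trace_diagonal, ← ih]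
    change (star U * (E ^ r) x * U).trace = _
    rw [trace_mul_comm, ← Matrix.mul_assoc, mul_eq_one_comm.1 hU, Matrix.one_mul]

theorem star_pow_apply
    (hE : ∀ x, E x = V * diagonal (star U * x * U).diag * star V) (r : ℕ) (x : Matrix ι ι ℂ)
    (hx : star x = x) : star ((E ^ r) x) = (E ^ r) x := by
  induction r with
  | zero => simpa using hx
  | succ r ih =>
    rw [pow_succ', Module.End.mul_apply, hE]
    have h : star (diagonal (star U * (E ^ r) x * U).diag) =
        diagonal (star U * (E ^ r) x * U).diag := by
      rw [star_eq_conjTranspose, diagonal_conjTranspose, ← diag_conjTranspose,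
        ← star_eq_conjTranspose, star_mul, star_mul, star_star, ih, Matrix.mul_assoc]
    rw [star_mul, star_mul, star_star, h, ← Matrix.mul_assoc]

theorem apply_conj_coordProj (hU : star U * U = 1)
    (hE : ∀ x, E x = V * diagonal (star U * x * U).diag * star V) (K : Finset ι) :
    E (U * coordProj K * star U) = V * coordProj K * star V := by
  have : star U * (U * coordProj K * star U) * U =
      (star U * U) * coordProj K * (star U * U) := by simp only [Matrix.mul_assoc]
  rw [hE, this, hU, Matrix.one_mul, Matrix.mul_one, coordProj, diag_diagonal]

theorem conj_coordProj_mem_multDomain (hU : star U * U = 1) (hV : star V * V = 1)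
    (hE : ∀ x, E x = V * diagonal (star U * x * U).diag * star V) (K : Finset ι) :
    U * coordProj K * star U ∈ multDomain E := by
  intro y
  rw [apply_conj_coordProj hU hE, hE, hE, hE]
  constructor
  · have h : star U * (U * coordProj K * star U * y) * U =
        (star U * U) * coordProj K * (star U * y * U) := by simp only [Matrix.mul_assoc]
    rw [h, hU, Matrix.one_mul, diag_coordProj_mul]
    calc _ = V * coordProj K * 1 * diagonal (star U * y * U).diag * star V := by
          simp only [Matrix.mul_assoc, Matrix.one_mul]
      _ = _ := by rw [← hV]; simp only [Matrix.mul_assoc]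
  · have h : star U * (y * (U * coordProj K * star U)) * U =
        (star U * y * U) * coordProj K * (star U * U) := by simp only [Matrix.mul_assoc]
    rw [h, hU, Matrix.mul_one, diag_mul_coordProj]
    calc _ = V * diagonal (star U * y * U).diag * 1 * coordProj K * star V := by
          simp only [Matrix.mul_assoc, Matrix.one_mul]
      _ = _ := by rw [← hV]; simp only [Matrix.mul_assoc]

theorem mem_multDomain_pow (hU : star U * U = 1) (hV : star V * V = 1)
    (hE : ∀ x, E x = V * diagonal (star U * x * U).diag * star V) (r : ℕ) (p : Matrix ι ι ℂ)
    (h : ∀ k < r, ∃ K, (E ^ k) p = U * coordProj K * star U) :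
    p ∈ multDomain (E ^ r) := by
  induction r with
  | zero => intro y; simp
  | succ r ih =>
    intro y
    obtain ⟨K, hK⟩ := h r (Nat.lt_succ_self r)
    have hmem := conj_coordProj_mem_multDomain hU hV hE K ((E ^ r) y)
    obtain ⟨h₁, h₂⟩ := ih (fun k hk => h k (hk.trans (Nat.lt_succ_self r))) y
    rw [← hK] at hmem
    simp only [pow_succ', Module.End.mul_apply, h₁, h₂]
    exact hmem

theorem exists_coordProj_of_frobSq_le (hU : star U * U = 1) (hV : star V * V = 1)
    (hE : ∀ x, E x = V * diagonal (star U * x * U).diag * star V) (p : Matrix ι ι ℂ)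
    (hp : p * p = p) (h : frobSq p ≤ frobSq (E p)) :
    ∃ K, p = U * coordProj K * star U := by
  have hU' : U * star U = 1 := mul_eq_one_comm.1 hU
  have hN : frobSq (star U * p * U) = frobSq p := by
    simpa using frobSq_conj (star U) p (by simpa using hU')
  have hdiag := eq_diagonal_of_frobSq_le (star U * p * U) (by
    rwa [hN, ← frobSq_conj V (diagonal _) hV, ← hE])
  have hz : (star U * p * U) * (star U * p * U) = star U * p * U := by
    simpa using conj_mul_self (star U) p (by simpa using hU') hp
  rw [hdiag] at hz
  obtain ⟨K, hK⟩ := exists_diagonal_eq_coordProj _ hz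
  refine ⟨K, ?_⟩
  rw [← hK, ← hdiag]
  calc p = (U * star U) * p * (U * star U) := by rw [hU', Matrix.one_mul, Matrix.mul_one]
    _ = _ := by simp only [Matrix.mul_assoc]

theorem pow_apply_eq_coordProj (hU : star U * U = 1) (hV : star V * V = 1)
    (hE : ∀ x, E x = V * diagonal (star U * x * U).diag * star V) (r : ℕ) (p : Matrix ι ι ℂ)
    (hp : p * p = p) (h : frobSq p ≤ frobSq ((E ^ r) p)) :
    ∀ k < r, ∃ K, (E ^ k) p = U * coordProj K * star U := by
  induction r generalizing p with
  | zero => simp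
  | succ r ih =>
    rw [pow_succ, Module.End.mul_apply] at h
    obtain ⟨K, hK⟩ := exists_coordProj_of_frobSq_le hU hV hE p hp
      (h.trans (frobSq_pow_apply_le hU hV hE r _))
    have hEp : E p = V * coordProj K * star V := by rw [hK, apply_conj_coordProj hU hE]
    rintro (_ | k) hk
    · exact ⟨K, by simpa using hK⟩
    · rw [pow_succ, Module.End.mul_apply]
      refine ih (E p) ?_ ((frobSq_apply_le hU hV hE p).trans h) k (by omega)
      rw [hEp]
      exact conj_mul_self V _ hV (coordProj_mul_self K)

theorem mem_multDomain_pow_iff (hU : star U * U = 1) (hV : star V * V = 1)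
    (hE : ∀ x, E x = V * diagonal (star U * x * U).diag * star V) (r : ℕ) (p : Matrix ι ι ℂ)
    (hp : p * p = p) (hps : star p = p) :
    p ∈ multDomain (E ^ r) ↔ ∀ k < r, ∃ K, (E ^ k) p = U * coordProj K * star U := by
  refine ⟨fun h => pow_apply_eq_coordProj hU hV hE r p hp ?_, mem_multDomain_pow hU hV hE r p⟩
  have hN : (frobSq ((E ^ r) p) : ℂ) = frobSq p := by
    rw [ofReal_frobSq, ofReal_frobSq, star_pow_apply hE r p hps, ← (h p).1,
      trace_pow_apply hU hV hE, hps]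
  exact_mod_cast hN.ge

end Channel

theorem star_mul_self_of_orthonormal (v : ι → ι → ℂ)
    (hv : ∀ i j, (∑ a, star (v i a) * v j a) = if i = j then (1 : ℂ) else 0) :
    star (of v)ᵀ * (of v)ᵀ = 1 := by
  ext i j
  rw [one_apply, ← hv i j]
  simp [mul_apply]

theorem sum_vecMulVec_mul_eq (v w : ι → ι → ℂ) (x : Matrix ι ι ℂ) :
    ∑ i, vecMulVec (v i) (star (w i)) * x * vecMulVec (w i) (star (v i)) =
      (of v)ᵀ * diagonal (star (of w)ᵀ * x * (of w)ᵀ).diag * star (of v)ᵀ := by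
  ext a b
  rw [Matrix.sum_apply, mul_apply]
  refine Finset.sum_congr rfl fun i _ => ?_
  rw [vecMulVec_mul, vecMulVec_mul_vecMulVec, mul_diagonal]
  have h : (star (of w)ᵀ * x * (of w)ᵀ) i i = (star (w i) ᵥ* x) ⬝ᵥ w i := by
    simp [mul_apply, vecMul, dotProduct]
  simp [vecMulVec_apply, h]
  ring

end DiagonalCompression

/-- Let `E` be the unital entanglement breaking channel built from
orthonormal bases `{φ i}`, `{ζ i}` as `E x = ∑ i, (φ i ζ i*) x (ζ i φ i*)`. A projection
`p` lies in the multiplicative domain of `E^r` (`1 ≤ r ≤ d`) iff there are subsets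
`K 0, …, K (r-1)` of `{1, …, d}`, each of cardinality `rank p`, with
`∑_{k ∈ K 0} ζ k ζ k* = p` and `∑_{k ∈ K i} φ k φ k* = ∑_{k ∈ K (i+1)} ζ k ζ k*`. -/
theorem stmt15 (d : ℕ) (φ ζ : Fin d → (Fin d → ℂ))
    (hφ : ∀ i j, (∑ a, star (φ i a) * φ j a) = if i = j then (1 : ℂ) else 0)
    (hζ : ∀ i j, (∑ a, star (ζ i a) * ζ j a) = if i = j then (1 : ℂ) else 0)
    (E : Module.End ℂ (Matrix (Fin d) (Fin d) ℂ))
    (hE : ∀ x, E x = ∑ i, Matrix.vecMulVec (φ i) (star (ζ i)) * x *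
      Matrix.vecMulVec (ζ i) (star (φ i)))
    (r : ℕ) (hr1 : 1 ≤ r) (hrd : r ≤ d)
    (p : Matrix (Fin d) (Fin d) ℂ) (hp : p * p = p) (hps : star p = p) :
    p ∈ multDomain (E ^ r) ↔
      ∃ K : Fin r → Finset (Fin d),
        (∀ i, (K i).card = p.rank) ∧
        (∑ kk ∈ K ⟨0, by omega⟩, Matrix.vecMulVec (ζ kk) (star (ζ kk))) = p ∧
        ∀ (i : ℕ) (h : i + 1 < r),
          (∑ kk ∈ K ⟨i, by omega⟩, Matrix.vecMulVec (φ kk) (star (φ kk))) =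
            ∑ kk ∈ K ⟨i + 1, h⟩, Matrix.vecMulVec (ζ kk) (star (ζ kk)) := by
  have hU := DiagonalCompression.star_mul_self_of_orthonormal ζ hζ
  have hV := DiagonalCompression.star_mul_self_of_orthonormal φ hφ
  have hE' := fun x => (hE x).trans (DiagonalCompression.sum_vecMulVec_mul_eq φ ζ x)
  have happ := DiagonalCompression.apply_conj_coordProj hU hE'
  rw [DiagonalCompression.mem_multDomain_pow_iff hU hV hE' r p hp hps]
  simp only [DiagonalCompression.sum_vecMulVec_eq]
  constructor
  · intro h
    choose K hK using h
    refine ⟨fun i => K i i.2, fun i => ?_, ?_, fun i h => ?_⟩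
    · have htr := congrArg Matrix.trace (hK i i.2)
      rw [DiagonalCompression.trace_pow_apply hU hV hE',
        DiagonalCompression.trace_eq_rank_of_mul_self p hp, Matrix.trace_mul_comm,
        ← Matrix.mul_assoc, hU, Matrix.one_mul, DiagonalCompression.trace_coordProj] at htr
      exact_mod_cast htr.symm
    · simpa using (hK 0 (by omega)).symm
    · rw [← hK (i + 1) h, pow_succ', Module.End.mul_apply, hK i (by omega), happ]
  · rintro ⟨K, -, h0, hstep⟩ k hk
    refine ⟨K ⟨k, hk⟩, ?_⟩
    induction k with
    | zero => simpa using h0.symm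
    | succ k ih =>
      rw [pow_succ', Module.End.mul_apply, ih (by omega), happ, hstep k hk]
end
end

section
/- For every integer d ≥ 1 and every integer r with 1 ≤ r ≤ d, there exists a unital entanglement breaking quantum channel E : M_d → M_d whose multiplicative index equals r, i.e. κ(E) = r. -/
open scoped Kronecker ComplexOrder

noncomputable section

/-- A channel is entanglement breaking if it admits rank-one Kraus operators. -/
def IsEntanglementBreaking {d : ℕ} (E : Module.End ℂ (Matrix (Fin d) (Fin d) ℂ)) : Prop :=
  ∃ (N : ℕ) (φ ζ : Fin N → (Fin d → ℂ)), ∀ x, E x =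
    ∑ i, Matrix.vecMulVec (φ i) (star (ζ i)) * x * Matrix.vecMulVec (ζ i) (star (φ i))

open Matrix

/-- The channel `x ↦ U Δ(x) Uᴴ`, where `Δ` keeps only the diagonal of a matrix. -/
def dephaseConj {ι : Type*} [Fintype ι] [DecidableEq ι] (U : Matrix ι ι ℂ) :
    Module.End ℂ (Matrix ι ι ℂ) where
  toFun x := U * diagonal x.diag * Uᴴ
  map_add' x y := by
    rw [diag_add, ← Matrix.add_mul, ← Matrix.mul_add, diagonal_add]
    rfl
  map_smul' c x := by
    simp [diag_smul, diagonal_smul]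

/-- The matrix of squared moduli of the entries of `U`. -/
def absSq {ι : Type*} (U : Matrix ι ι ℂ) : Matrix ι ι ℂ :=
  of fun i j => U i j * star (U i j)

section DephaseConj

variable {ι : Type*} [Fintype ι] [DecidableEq ι] {U : Matrix ι ι ℂ}

lemma dephaseConj_apply (U x : Matrix ι ι ℂ) :
    dephaseConj U x = U * diagonal x.diag * Uᴴ := rfl

lemma dephaseConj_apply_apply (U x : Matrix ι ι ℂ) (a b : ι) :
    dephaseConj U x a b = ∑ i, U a i * x i i * star (U b i) := by
  rw [dephaseConj_apply, Matrix.mul_apply]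
  simp only [mul_diagonal, conjTranspose_apply, diag_apply]

lemma isQuantumChannel_dephaseConj (hU : U * Uᴴ = 1) : IsQuantumChannel (dephaseConj U) := by
  refine ⟨fun n A hA => ?_, fun x => ?_⟩
  · have h : ampl n (dephaseConj U) A =
        ∑ i, A.submatrix (fun p => (p, i)) (fun p => (p, i)) ⊗ₖ
          vecMulVec (fun a => U a i) (star fun a => U a i) := by
      ext ⟨p, a⟩ ⟨q, b⟩
      simp only [ampl, of_apply, dephaseConj_apply_apply, Matrix.sum_apply, kroneckerMap_apply,
        submatrix_apply, vecMulVec_apply, Pi.star_apply]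
      exact Finset.sum_congr rfl fun i _ => by ring
    rw [h]
    exact posSemidef_sum _ fun i _ =>
      (hA.submatrix _).kronecker (posSemidef_vecMulVec_self_star _)
  · rw [dephaseConj_apply, trace_mul_comm, ← Matrix.mul_assoc, mul_eq_one_comm.1 hU,
      Matrix.one_mul, trace_diagonal]
    rfl

lemma dephaseConj_one (hU : U * Uᴴ = 1) : dephaseConj U 1 = 1 := by
  simp [dephaseConj_apply, hU]

lemma isEntanglementBreaking_dephaseConj {d : ℕ} (U : Matrix (Fin d) (Fin d) ℂ) :
    IsEntanglementBreaking (dephaseConj U) := by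
  refine ⟨d, fun i a => U a i, fun i => Pi.single i 1, fun x => ?_⟩
  ext a b
  simp [dephaseConj_apply_apply, Matrix.sum_apply, Matrix.mul_apply, vecMulVec_apply,
    Pi.single_apply]

lemma diag_mul_diagonal_mul_conjTranspose (U : Matrix ι ι ℂ) (w : ι → ℂ) :
    (U * diagonal w * Uᴴ).diag = absSq U *ᵥ w := by
  ext i
  rw [diag_apply, Matrix.mul_apply]
  simp only [mul_diagonal, conjTranspose_apply, mulVec, dotProduct,
    absSq, of_apply]
  exact Finset.sum_congr rfl fun j _ => by ring

lemma dephaseConj_pow_succ_apply (U x : Matrix ι ι ℂ) (n : ℕ) :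
    (dephaseConj U ^ (n + 1)) x = U * diagonal (absSq U ^ n *ᵥ x.diag) * Uᴴ := by
  induction n with
  | zero => simp [dephaseConj_apply]
  | succ n ih =>
    rw [pow_succ', Module.End.mul_apply, ih, dephaseConj_apply,
      diag_mul_diagonal_mul_conjTranspose, mulVec_mulVec, ← pow_succ']

lemma absSq_pow_nonneg (U : Matrix ι ι ℂ) (n : ℕ) (i j : ι) : 0 ≤ (absSq U ^ n) i j := by
  induction n generalizing j with
  | zero => rw [pow_zero, one_apply]; split_ifs <;> simp
  | succ n ih =>
    rw [pow_succ, Matrix.mul_apply]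
    exact Finset.sum_nonneg fun k _ => mul_nonneg (ih k) (mul_star_self_nonneg _)

lemma absSq_pow_mulVec_one (hU : U * Uᴴ = 1) (n : ℕ) : absSq U ^ n *ᵥ 1 = 1 := by
  induction n with
  | zero => simp
  | succ n ih =>
    have h : absSq U *ᵥ 1 = 1 := by
      rw [← diag_mul_diagonal_mul_conjTranspose]
      ext i
      simp [hU, Pi.one_def]
    rw [pow_succ, ← mulVec_mulVec, h, ih]

lemma one_vecMul_absSq_pow (hU : U * Uᴴ = 1) (n : ℕ) : 1 ᵥ* absSq U ^ n = 1 := by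
  induction n with
  | zero => simp
  | succ n ih =>
    have h : 1 ᵥ* absSq U = 1 := by
      ext j
      have hj : (Uᴴ * U) j j = 1 := by rw [mul_eq_one_comm.1 hU, one_apply_eq]
      rw [Matrix.mul_apply] at hj
      simpa [vecMul, dotProduct, absSq, mul_comm] using hj
    rw [pow_succ, ← vecMul_vecMul, ih, h]

lemma mem_multDomain_dephaseConj_pow_iff (hU : U * Uᴴ = 1) (n : ℕ) (x : Matrix ι ι ℂ) :
    x ∈ multDomain (dephaseConj U ^ (n + 1)) ↔
      (∀ i j, i ≠ j → x i j = 0) ∧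
        ∀ k i j, (absSq U ^ n) k i ≠ 0 → (absSq U ^ n) k j ≠ 0 → x i i = x j j := by
  have hU' := mul_eq_one_comm.1 hU
  have hrow := absSq_pow_mulVec_one hU n
  have hcol := one_vecMul_absSq_pow hU n
  generalize hC : absSq U ^ n = C at hrow hcol ⊢
  have hmul (y z : Matrix ι ι ℂ) :
      (dephaseConj U ^ (n + 1)) (y * z) =
          (dephaseConj U ^ (n + 1)) y * (dephaseConj U ^ (n + 1)) z ↔
        C *ᵥ (y * z).diag = (C *ᵥ y.diag) * (C *ᵥ z.diag) := by
    simp only [dephaseConj_pow_succ_apply, hC]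
    have h (v w : ι → ℂ) : U * diagonal v * Uᴴ * (U * diagonal w * Uᴴ) =
        U * diagonal (v * w) * Uᴴ := by
      calc _ = U * diagonal v * (Uᴴ * U) * diagonal w * Uᴴ := by simp only [Matrix.mul_assoc]
        _ = _ := by
          rw [hU', Matrix.mul_one, Matrix.mul_assoc U, diagonal_mul_diagonal]
          rfl
    rw [h]
    refine ⟨fun e => ?_, fun e => by rw [e]⟩
    have e' := congrArg (fun m => Uᴴ * m * U) e
    have h' (v : ι → ℂ) : Uᴴ * (U * diagonal v * Uᴴ) * U = diagonal v := by
      calc _ = (Uᴴ * U) * diagonal v * (Uᴴ * U) := by simp only [Matrix.mul_assoc]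
        _ = _ := by simp [hU']
    simp only [h'] at e'
    exact diagonal_injective e'
  simp only [multDomain, Set.mem_ofPred_eq, hmul]
  constructor
  · intro hx
    have key (i j k : ι) : C k j * x j i = (C *ᵥ x.diag) k * (C k j * if i = j then 1 else 0) := by
      have h := congr_fun (hx (single i j 1)).1 k
      rcases eq_or_ne i j with rfl | hij
      · simpa [mulVec, dotProduct, Matrix.mul_apply, single_apply, ite_and] using h
      · simpa [mulVec, dotProduct, Matrix.mul_apply, single_apply, ite_and, hij] using h
    refine ⟨fun j i hij => ?_, fun k i j hi hj => ?_⟩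
    · have h1 := congr_fun hcol j
      simp only [vecMul, dotProduct, Pi.one_apply, one_mul] at h1
      rw [← one_mul (x j i), ← h1, Finset.sum_mul]
      exact Finset.sum_eq_zero fun k _ => by rw [key, if_neg hij.symm]; simp
    · have e (l : ι) (hl : C k l ≠ 0) : x l l = (C *ᵥ x.diag) k := by
        have h := key l l k
        rw [if_pos rfl, mul_one, mul_comm] at h
        exact mul_right_cancel₀ hl h
      rw [e i hi, e j hj]
  · rintro ⟨h0, hc⟩ y
    have hx : x = diagonal x.diag := by
      ext i j
      by_cases h : i = j
      · subst h; simp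
      · simp [h, h0 i j h]
    have key (k : ι) : ∃ t, ∀ i, C k i * x i i = t * C k i := by
      by_cases h : ∃ j, C k j ≠ 0
      · obtain ⟨j, hj⟩ := h
        refine ⟨x j j, fun i => ?_⟩
        by_cases hi : C k i = 0
        · simp [hi]
        · rw [hc k i j hi hj, mul_comm]
      · push Not at h
        exact ⟨0, fun i => by simp [h i]⟩
    have hyx : (y * x).diag = (x * y).diag := by
      ext i
      rw [hx]
      simp [mul_comm]
    have main : C *ᵥ (x * y).diag = (C *ᵥ x.diag) * (C *ᵥ y.diag) := by
      ext k
      obtain ⟨t, ht⟩ := key k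
      have h1 : (C *ᵥ x.diag) k = t := by
        have := congr_fun hrow k
        simp only [mulVec, dotProduct, Pi.one_apply, mul_one] at this
        simp only [mulVec, dotProduct, diag_apply, ht, ← Finset.mul_sum, this, mul_one]
      have h2 (i : ι) : (x * y) i i = x i i * y i i := by
        rw [hx]
        simp
      rw [Pi.mul_apply, h1]
      simp only [mulVec, dotProduct, diag_apply, h2, Finset.mul_sum, ← mul_assoc, ht]
    exact ⟨main, by rw [hyx, main, mul_comm]⟩

end DephaseConj

/-- A unitary mixing the first two basis vectors and then shifting the first `r` cyclically. -/
lemma exists_unitary_mixing_shift {d r : ℕ} (hr1 : 1 ≤ r) (hrd : r ≤ d) :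
    ∃ U : Matrix (Fin d) (Fin d) ℂ, U * Uᴴ = 1 ∧
      (∀ i : Fin d, (i : ℕ) = 0 → U i i ≠ 0) ∧
      (∀ i j : Fin d, (j : ℕ) = i + 1 → (j : ℕ) < r → U i j ≠ 0) ∧
      (∀ l i j : Fin d, U l i ≠ 0 → U l j ≠ 0 →
        i = j ∨ ((i : ℕ) < r ∧ (i : ℕ) ≤ 1) ∧ ((j : ℕ) < r ∧ (j : ℕ) ≤ 1)) ∧
      ∀ l i : Fin d, (l : ℕ) < r → U l i ≠ 0 → (i : ℕ) < r ∧ (i : ℕ) ≤ l + 1 := by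
  obtain rfl | hr2 := hr1.eq_or_lt
  · refine ⟨1, by simp, by simp, fun i j h1 h2 => by omega, fun l i j hi hj => ?_,
      fun l i hl hi => ?_⟩
    · left
      simp only [one_apply, ne_eq, ite_eq_right_iff, one_ne_zero, imp_false, not_not] at hi hj
      rw [← hi, ← hj]
    · simp only [one_apply, ne_eq, ite_eq_right_iff, one_ne_zero, imp_false, not_not] at hi
      subst hi
      omega
  · let u : Fin d → Fin d → ℂ := fun l =>
      if hl : r ≤ l then Pi.single l 1
      else if h0 : (l : ℕ) = 0 then
        Pi.single ⟨0, by omega⟩ (3 / 5) + Pi.single ⟨1, by omega⟩ (4 / 5)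
      else if h1 : (l : ℕ) + 1 = r then
        Pi.single ⟨0, by omega⟩ (4 / 5) - Pi.single ⟨1, by omega⟩ (3 / 5)
      else Pi.single ⟨l + 1, by omega⟩ 1
    have hu (l i : Fin d) : of u l i =
        if r ≤ (l : ℕ) then if i = l then 1 else 0
        else if (l : ℕ) = 0 then
          if (i : ℕ) = 0 then 3 / 5 else if (i : ℕ) = 1 then 4 / 5 else 0
        else if (l : ℕ) + 1 = r then
          if (i : ℕ) = 0 then 4 / 5 else if (i : ℕ) = 1 then - (3 / 5) else 0
        else if (i : ℕ) = l + 1 then 1 else 0 := by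
      simp only [u, of_apply]
      split_ifs <;> simp_all [Pi.single_apply, Fin.ext_iff]
    refine ⟨of u, ?_, fun i hi => ?_, fun i j hj hjr => ?_, fun l i j hi hj => ?_,
      fun l i hl hi => ?_⟩
    · ext l m
      have key : (of u * (of u)ᴴ) l m = u l ⬝ᵥ star (u m) := rfl
      rw [key, one_apply]
      simp only [u, Fin.ext_iff]
      split_ifs <;> first | omega | skip
      all_goals simp [Pi.single_apply, Fin.ext_iff]
      all_goals
        first
        | omega
        | norm_num; done
        | split_ifs <;> first | omega | simp
    · rw [hu]
      split_ifs <;> first | omega | norm_num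
    · rw [hu]
      split_ifs <;> first | omega | norm_num
    · rw [hu] at hi hj
      simp only [Fin.ext_iff] at hi hj ⊢
      split_ifs at hi hj <;> first | omega | simp at hi hj
    · rw [hu] at hi
      simp only [Fin.ext_iff] at hi
      split_ifs at hi <;> first | omega | simp at hi

/-- The diagonal matrices whose first `min r (n + 1)` diagonal entries agree. -/
def diagConstOn (d r n : ℕ) : Set (Matrix (Fin d) (Fin d) ℂ) :=
  {x | (∀ i j, i ≠ j → x i j = 0) ∧
    ∀ i j : Fin d, (i : ℕ) < r ∧ (i : ℕ) ≤ n → (j : ℕ) < r ∧ (j : ℕ) ≤ n → x i i = x j j}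

/-- For every `d ≥ 1` and every `1 ≤ r ≤ d` there is a unital
entanglement breaking quantum channel on `M_d` with multiplicative index exactly `r`. -/
theorem stmt16 (d r : ℕ) (hd : 1 ≤ d) (hr1 : 1 ≤ r) (hrd : r ≤ d) :
    ∃ E : Module.End ℂ (Matrix (Fin d) (Fin d) ℂ),
      IsQuantumChannel E ∧ E 1 = 1 ∧ IsEntanglementBreaking E ∧ multIndex E = r := by
  obtain ⟨U, hU, h00, hsucc, hrow, hlt⟩ := exists_unitary_mixing_shift hr1 hrd
  refine ⟨dephaseConj U, isQuantumChannel_dephaseConj hU, dephaseConj_one hU,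
    isEntanglementBreaking_dephaseConj U, ?_⟩
  have hB (i j : Fin d) : absSq U i j ≠ 0 ↔ U i j ≠ 0 := by simp [absSq]
  have hpos (n : ℕ) (i k j : Fin d) (h1 : (absSq U ^ n) i k ≠ 0) (h2 : U k j ≠ 0) :
      (absSq U ^ (n + 1)) i j ≠ 0 := by
    have h0 (l : Fin d) : 0 ≤ (absSq U ^ n) i l * absSq U l j :=
      mul_nonneg (absSq_pow_nonneg U n i l) (mul_star_self_nonneg _)
    intro h
    rw [pow_succ, Matrix.mul_apply, Finset.sum_eq_zero_iff_of_nonneg fun l _ => h0 l] at h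
    exact mul_ne_zero h1 ((hB k j).2 h2) (h k (Finset.mem_univ k))
  have hzero (n : ℕ) (z : Fin d) (hz : (z : ℕ) = 0) : (absSq U ^ n) z z ≠ 0 := by
    induction n with
    | zero => simp
    | succ n ih => exact hpos n z z z ih (h00 z hz)
  have hfull (n : ℕ) (z i : Fin d) (hz : (z : ℕ) = 0) (hi : (i : ℕ) < r ∧ (i : ℕ) ≤ n) :
      (absSq U ^ n) z i ≠ 0 := by
    induction n generalizing i with
    | zero =>
      obtain rfl : i = z := Fin.ext (by omega)
      exact hzero 0 i hz
    | succ n ih =>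
      by_cases hi0 : (i : ℕ) = 0
      · obtain rfl : i = z := Fin.ext (by omega)
        exact hzero (n + 1) i hz
      · have hi' : (i : ℕ) - 1 < d := by omega
        exact hpos n z ⟨i - 1, hi'⟩ i (ih ⟨i - 1, hi'⟩ (by simp only; omega))
          (hsucc _ i (by simp only; omega) hi.1)
  have hsupp (n : ℕ) (k i j : Fin d) (hi : (absSq U ^ n) k i ≠ 0)
      (hj : (absSq U ^ n) k j ≠ 0) :
      i = j ∨ ((i : ℕ) < r ∧ (i : ℕ) ≤ n) ∧ ((j : ℕ) < r ∧ (j : ℕ) ≤ n) := by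
    induction n generalizing i j with
    | zero =>
      left
      rw [pow_zero, one_apply] at hi hj
      simp only [ne_eq, ite_eq_right_iff, one_ne_zero, imp_false, not_not] at hi hj
      rw [← hi, ← hj]
    | succ n ih =>
      have pred (i : Fin d) (hi : (absSq U ^ (n + 1)) k i ≠ 0) :
          ∃ l, (absSq U ^ n) k l ≠ 0 ∧ U l i ≠ 0 := by
        rw [pow_succ, Matrix.mul_apply] at hi
        obtain ⟨l, -, hl⟩ := Finset.exists_ne_zero_of_sum_ne_zero hi
        exact ⟨l, left_ne_zero_of_mul hl, (hB l i).1 (right_ne_zero_of_mul hl)⟩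
      obtain ⟨l, hl, hli⟩ := pred i hi
      obtain ⟨m, hm, hmj⟩ := pred j hj
      obtain rfl | ⟨hl', hm'⟩ := ih l m hl hm
      · exact (hrow l i j hli hmj).imp_right fun h => by omega
      · have := hlt l i hl'.1 hli
        have := hlt m j hm'.1 hmj
        right
        omega
  have hD (n : ℕ) : multDomain (dephaseConj U ^ (n + 1)) = diagConstOn d r n := by
    ext x
    rw [mem_multDomain_dephaseConj_pow_iff hU]
    refine and_congr_right fun _ => ⟨fun h i j hi hj => ?_, fun h k i j hi hj => ?_⟩
    · exact h ⟨0, hd⟩ i j (hfull n _ i rfl hi) (hfull n _ j rfl hj)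
    · obtain rfl | ⟨hi', hj'⟩ := hsupp n k i j hi hj
      · rfl
      · exact h i j hi' hj'
  obtain ⟨s, rfl⟩ : ∃ s, r = s + 1 := ⟨r - 1, by omega⟩
  refine IsLeast.csInf_eq ⟨⟨hr1, fun m hm => ?_⟩, fun n hn => ?_⟩
  · obtain ⟨t, rfl⟩ : ∃ t, m = t + 1 := ⟨m - 1, by omega⟩
    rw [hD, hD]
    ext x
    refine and_congr_right fun _ => forall₂_congr fun i j => ?_
    rw [show (i : ℕ) < s + 1 ∧ (i : ℕ) ≤ t ↔ (i : ℕ) < s + 1 ∧ (i : ℕ) ≤ s by omega,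
      show (j : ℕ) < s + 1 ∧ (j : ℕ) ≤ t ↔ (j : ℕ) < s + 1 ∧ (j : ℕ) ≤ s by omega]
  · obtain ⟨hn0, hn⟩ := hn
    by_contra! hlt'
    obtain ⟨t, rfl⟩ : ∃ t, n = t + 1 := ⟨n - 1, by omega⟩
    have e := hn (s + 1) hlt'.le
    rw [hD, hD] at e
    let a : Fin d := ⟨s, hrd⟩
    let z : Fin d := ⟨0, hd⟩
    have hza : z ≠ a := fun h => by
      have := congrArg Fin.val h
      simp only [z, a] at this
      omega
    have hmem : diagonal (Pi.single a (1 : ℂ)) ∈ diagConstOn d (s + 1) t := by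
      refine ⟨fun i j hij => diagonal_apply_ne _ hij, fun i j hi hj => ?_⟩
      have ne (i : Fin d) (hi : (i : ℕ) < s + 1 ∧ (i : ℕ) ≤ t) : i ≠ a := fun h => by
        have := congrArg Fin.val h
        simp only [a] at this
        omega
      simp [ne i hi, ne j hj]
    rw [← e] at hmem
    have := hmem.2 z a (by simp [z]) (by simp [a])
    simp [hza] at this
end
end
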